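/- arXiv:1105.2463 — 2 statements merged into one kernel-verified Lean document; each statement's English description precedes it below -/
import Mathlib

section
/- Let n, k ≥ 2, let F_n and F_k be free groups of ranks n and k with reduced-word lengths |·|, and for natural numbers s, t define the spherical mapping ratio e_γ(F_n, F_k, s, t) = #{(f,g) ∈ F_n×F_k : |f| = s, |g| = t, and φ(f) = g for some group homomorphism φ : F_n → F_k} / (#{f ∈ F_n : |f| = s} · #{g ∈ F_k : |g| = t}). Then for all ε, δ ∈ {0,1}: (2^n − 2(1−ε))/((2^n − 1) ζ(n)) ≤ liminf_{(s,t)→(∞,∞)} e_γ(F_n, F_k, 2s+ε, 2t+δ), and limsup_{(s,t)→(∞,∞)} e_γ(F_n, F_k, 2s+ε, 2t+δ) ≤ 1 − ((2^k − 2(1−δ))/((2^k − 1) ζ(k)))·(1 − (2^n − 2(1−ε))/((2^n − 1) ζ(n))). -/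
open Filter

/-- The Riemann zeta function at a natural number argument, ζ(s) = Σ_{m≥1} m^{-s}. -/
noncomputable def zetaR (r : ℕ) : ℝ := ∑' m : ℕ, 1 / ((m : ℝ) + 1) ^ r

/-- The spherical `(s,t)`-mapping ratio `e_γ(F_n, F_k, s, t)`: the proportion, among all
pairs `(f,g) ∈ F_n × F_k` with `|f| = s` and `|g| = t` (reduced-word lengths), of those
pairs for which `g` is the image of `f` under some group homomorphism `F_n → F_k`. -/
noncomputable def eGammaFree (n k : ℕ) (s t : ℕ) : ℝ :=
  ({fg : FreeGroup (Fin n) × FreeGroup (Fin k) |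
      fg.1.toWord.length = s ∧ fg.2.toWord.length = t ∧
      ∃ φ : FreeGroup (Fin n) →* FreeGroup (Fin k), φ fg.1 = fg.2}.ncard : ℝ) /
    (({f : FreeGroup (Fin n) | f.toWord.length = s}.ncard : ℝ) *
      ({g : FreeGroup (Fin k) | g.toWord.length = t}.ncard : ℝ))

namespace FreeGroupSphere

open Finset Topology

variable {n : ℕ}

/-! ### Three-term recurrences -/

/-- A perturbation of the recurrence with characteristic roots `1` and `b ≤ 1/3`. -/
lemma norm_le_of_recurrence {b h ρ M : ℝ} (hb0 : 0 ≤ b) (hb : b ≤ 1 / 3)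
    (hρ : |1 - h| + 2 * b * |h| ≤ ρ) (hρ' : 5 / 6 ≤ ρ) {x : ℕ → ℂ}
    (hx : ∀ s, x (s + 2) = ((1 + b - h : ℝ) : ℂ) * x (s + 1) - (b : ℂ) * x s)
    (h0 : ‖x 0‖ ≤ M) (h1 : ‖x 1‖ ≤ M) (s : ℕ) : ‖x s‖ ≤ 4 * M * ρ ^ s := by
  have hM : 0 ≤ M := (norm_nonneg _).trans h0
  have hρ0 : 0 ≤ ρ := by linarith
  have key : ∀ s, ‖x (s + 1) - b * x s‖ ≤ 2 * M * ρ ^ s ∧ ‖x s‖ / 2 ≤ 2 * M * ρ ^ s := by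
    intro s
    induction s with
    | zero =>
      refine ⟨(norm_sub_le _ _).trans ?_, by simp; linarith⟩
      rw [norm_mul, Complex.norm_real, Real.norm_of_nonneg hb0]
      have : b * ‖x 0‖ ≤ 1 / 3 * M := by gcongr
      simp only [zero_add, pow_zero, mul_one]
      linarith
    | succ s ih =>
      obtain ⟨i1, i2⟩ := ih
      set N := 2 * M * ρ ^ s with hN
      have hN0 : 0 ≤ N := by positivity
      have e1 : x (s + 1) = (x (s + 1) - b * x s) + b * x s := by ring
      have e2 : x (s + 1 + 1) - b * x (s + 1)
          = ((1 - h : ℝ) : ℂ) * (x (s + 1) - b * x s) - ((b * h : ℝ) : ℂ) * x s := by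
        rw [hx]; push_cast; ring
      have hs : 2 * M * ρ ^ (s + 1) = ρ * N := by rw [hN]; ring
      rw [hs]
      constructor
      · rw [e2]
        refine (norm_sub_le _ _).trans ?_
        rw [norm_mul, norm_mul, Complex.norm_real, Complex.norm_real, Real.norm_eq_abs,
          Real.norm_eq_abs, abs_mul, abs_of_nonneg hb0]
        have a1 : |1 - h| * ‖x (s + 1) - b * x s‖ ≤ |1 - h| * N := by gcongr
        have a2 : b * |h| * ‖x s‖ ≤ b * |h| * (2 * N) := by gcongr; linarith
        nlinarith [mul_le_mul_of_nonneg_right hρ hN0]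
      · have : ‖x (s + 1)‖ ≤ N + b * (2 * N) := by
          rw [e1]
          refine (norm_add_le _ _).trans ?_
          rw [norm_mul, Complex.norm_real, Real.norm_of_nonneg hb0]
          gcongr
          linarith
        have : b * (2 * N) ≤ 1 / 3 * (2 * N) := by gcongr
        nlinarith [mul_le_mul_of_nonneg_right hρ' hN0]
  have := (key s).2
  linarith

/-- The same recurrence when its leading coefficient is small. -/
lemma norm_le_of_recurrence_of_small {a b M : ℝ} (ha : |a| ≤ 1 / 3) (hb0 : 0 ≤ b) (hb : b ≤ 1 / 3)
    {x : ℕ → ℂ} (hx : ∀ s, x (s + 2) = (a : ℂ) * x (s + 1) - (b : ℂ) * x s)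
    (h0 : ‖x 0‖ ≤ M) (h1 : ‖x 1‖ ≤ M) (s : ℕ) : ‖x s‖ ≤ 4 * M * (7 / 9) ^ s := by
  have hM : 0 ≤ M := (norm_nonneg _).trans h0
  have key : ∀ s, ‖x (s + 1)‖ ≤ 2 * M * (7 / 9) ^ s ∧ 7 / 9 * ‖x s‖ ≤ 2 * M * (7 / 9) ^ s := by
    intro s
    induction s with
    | zero => constructor <;> simp <;> linarith
    | succ s ih =>
      obtain ⟨i1, i2⟩ := ih
      set N := 2 * M * (7 / 9) ^ s with hN
      have hs : 2 * M * (7 / 9) ^ (s + 1) = 7 / 9 * N := by rw [hN]; ring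
      rw [hs]
      refine ⟨?_, by linarith⟩
      rw [hx]
      refine (norm_sub_le _ _).trans ?_
      rw [norm_mul, norm_mul, Complex.norm_real, Complex.norm_real, Real.norm_eq_abs,
          Real.norm_of_nonneg hb0]
      have a1 : |a| * ‖x (s + 1)‖ ≤ 1 / 3 * ‖x (s + 1)‖ := by gcongr
      have a2 : b * ‖x s‖ ≤ 1 / 3 * ‖x s‖ := by gcongr
      linarith [norm_nonneg (x (s + 1))]
  have := (key s).2
  have h7 : 0 ≤ M * (7 / 9 : ℝ) ^ s := by positivity
  linarith

lemma norm_le_exp_of_recurrence_of_nonneg {a b M : ℝ} (ha0 : 0 ≤ a) (hb0 : 0 ≤ b) (hb : b ≤ 1 / 3)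
    (hab : a ≤ 1 + b) {x : ℕ → ℂ} (hx : ∀ s, x (s + 2) = (a : ℂ) * x (s + 1) - (b : ℂ) * x s)
    (h0 : ‖x 0‖ ≤ M) (h1 : ‖x 1‖ ≤ M) (s : ℕ) :
    ‖x s‖ ≤ 4 * M * Real.exp (-(1 + b - a) / 6 * s) := by
  have hM : 0 ≤ M := (norm_nonneg _).trans h0
  set h := 1 + b - a with hh
  have hexp : (1 - h / 6) ^ s ≤ Real.exp (-h / 6 * s) := by
    have : 1 - h / 6 ≤ Real.exp (-h / 6) := by
      have := Real.add_one_le_exp (-h / 6); linarith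
    rw [mul_comm, Real.exp_nat_mul]
    exact pow_le_pow_left₀ (by linarith) this s
  rcases le_or_gt h 1 with h1' | h1'
  · have : ‖x s‖ ≤ 4 * M * (1 - h / 6) ^ s := by
      refine norm_le_of_recurrence (b := b) (h := h) hb0 hb ?_ (by linarith) ?_ h0 h1 s
      · rw [abs_of_nonneg (by linarith), abs_of_nonneg (by linarith)]
        nlinarith
      · intro s; rw [hx]; simp [hh]
    exact this.trans (by gcongr)
  · have : ‖x s‖ ≤ 4 * M * (7 / 9) ^ s :=
      norm_le_of_recurrence_of_small (by rw [abs_of_nonneg ha0]; linarith) hb0 hb hx h0 h1 s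
    refine this.trans ?_
    refine mul_le_mul_of_nonneg_left (le_trans ?_ hexp) (by positivity)
    exact pow_le_pow_left₀ (by norm_num) (by linarith) s

lemma norm_le_exp_of_recurrence {a b M : ℝ} (hb0 : 0 ≤ b) (hb : b ≤ 1 / 3) (hab : |a| ≤ 1 + b)
    {x : ℕ → ℂ} (hx : ∀ s, x (s + 2) = (a : ℂ) * x (s + 1) - (b : ℂ) * x s)
    (h0 : ‖x 0‖ ≤ M) (h1 : ‖x 1‖ ≤ M) (s : ℕ) :
    ‖x s‖ ≤ 4 * M * Real.exp (-(1 + b - |a|) / 6 * s) := by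
  rcases le_total 0 a with ha | ha
  · rw [abs_of_nonneg ha] at hab ⊢
    exact norm_le_exp_of_recurrence_of_nonneg ha hb0 hb hab hx h0 h1 s
  · have := norm_le_exp_of_recurrence_of_nonneg (a := |a|) (x := fun s => (-1) ^ s * x s)
      (abs_nonneg a) hb0 hb hab ?_ (by simpa using h0) (by simpa using h1) s
    · simpa using this
    · intro s
      simp only [hx, abs_of_nonpos ha]
      push_cast
      ring

/-! ### Spheres and character sums -/

/-- The reduced words of length `s` that remain reduced when preceded by the letter `x`. -/
def tails (n : ℕ) : ℕ → Fin n × Bool → Finset (List (Fin n × Bool))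
  | 0, _ => {[]}
  | s + 1, x => (univ.filter fun y : Fin n × Bool => x.1 = y.1 → x.2 = y.2).biUnion fun y =>
      (tails n s y).map ⟨List.cons y, List.cons_injective⟩

lemma mem_tails {s : ℕ} {x : Fin n × Bool} {L : List (Fin n × Bool)} :
    L ∈ tails n s x ↔ L.length = s ∧ FreeGroup.IsReduced (x :: L) := by
  induction s generalizing x L with
  | zero =>
    simp only [tails, mem_singleton, List.length_eq_zero_iff]
    exact ⟨fun h => ⟨h, h ▸ FreeGroup.IsReduced.singleton⟩, fun h => h.1⟩
  | succ s ih =>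
    cases L with
    | nil => simp [tails]
    | cons y L =>
      simp [tails, ih, FreeGroup.isReduced_cons_cons]
      tauto

lemma finite_sphere (n s : ℕ) : {f : FreeGroup (Fin n) | f.toWord.length = s}.Finite :=
  Set.Finite.of_finite_image
    ((List.finite_length_eq (Fin n × Bool) s).subset (by rintro _ ⟨f, hf, rfl⟩; exact hf))
    FreeGroup.toWord_injective.injOn

/-- The sphere of radius `s` in the free group of rank `n`. -/
noncomputable def sphere (n s : ℕ) : Finset (FreeGroup (Fin n)) := (finite_sphere n s).toFinset

@[simp] lemma mem_sphere {s : ℕ} {f : FreeGroup (Fin n)} :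
    f ∈ sphere n s ↔ f.toWord.length = s := by simp [sphere]

lemma sum_sphere_succ {M : Type*} [AddCommMonoid M] (s : ℕ) (F : FreeGroup (Fin n) → M) :
    ∑ f ∈ sphere n (s + 1), F f = ∑ y, ∑ L ∈ tails n s y, F (FreeGroup.mk (y :: L)) := by
  rw [Finset.sum_sigma']
  symm
  refine Finset.sum_bij (fun p _ => FreeGroup.mk (p.1 :: p.2)) ?_ ?_ ?_ ?_
  · rintro ⟨y, L⟩ h
    simp only [mem_sigma, mem_univ, true_and, mem_tails] at h
    simp [FreeGroup.toWord_mk, h.2.reduce_eq, h.1, -FreeGroup.reduce.cons]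
  · rintro ⟨y, L⟩ h ⟨y', L'⟩ h' he
    simp only [mem_sigma, mem_univ, true_and, mem_tails] at h h'
    have := congrArg FreeGroup.toWord he
    rw [FreeGroup.toWord_mk, FreeGroup.toWord_mk, h.2.reduce_eq, h'.2.reduce_eq] at this
    simp at this
    simp [this]
  · intro f hf
    rw [mem_sphere] at hf
    obtain ⟨y, L, hL⟩ := List.exists_cons_of_length_eq_add_one hf
    refine ⟨⟨y, L⟩, ?_, ?_⟩
    · simp only [mem_sigma, mem_univ, true_and, mem_tails]
      exact ⟨by simpa [hL] using hf, hL ▸ FreeGroup.isReduced_toWord⟩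
    · simp only [← hL, FreeGroup.mk_toWord]
  · simp

/-- The value of the character with generator values `w` on a letter. -/
def letterWeight (w : Fin n → ℂˣ) (x : Fin n × Bool) : ℂ :=
  ((cond x.2 (w x.1) (w x.1)⁻¹ : ℂˣ) : ℂ)

/-- The sum over a sphere of the character with generator values `w`. -/
noncomputable def charSum (w : Fin n → ℂˣ) (s : ℕ) : ℂ :=
  ∑ f ∈ sphere n s, (FreeGroup.lift w f : ℂ)

/-- The weight of the tails that may follow the letter `x`. -/
noncomputable def tailSum (w : Fin n → ℂˣ) (s : ℕ) (x : Fin n × Bool) : ℂ :=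
  ∑ L ∈ tails n s x, (L.map (letterWeight w)).prod

lemma coe_lift_mk (w : Fin n → ℂˣ) (L : List (Fin n × Bool)) :
    (FreeGroup.lift w (FreeGroup.mk L) : ℂ) = (L.map (letterWeight w)).prod := by
  rw [FreeGroup.lift_mk, ← Units.coeHom_apply, map_list_prod, List.map_map]
  rfl

lemma charSum_succ (w : Fin n → ℂˣ) (s : ℕ) :
    charSum w (s + 1) = ∑ y, letterWeight w y * tailSum w s y := by
  simp only [charSum, sum_sphere_succ, coe_lift_mk, tailSum, mul_sum, List.map_cons,
    List.prod_cons]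

lemma tailSum_zero (w : Fin n → ℂˣ) (x : Fin n × Bool) : tailSum w 0 x = 1 := by
  simp [tailSum, tails]

/-- The inverse of a letter. -/
def invLetter (x : Fin n × Bool) : Fin n × Bool := (x.1, !x.2)

lemma letterWeight_mul_invLetter (w : Fin n → ℂˣ) (x : Fin n × Bool) :
    letterWeight w x * letterWeight w (invLetter x) = 1 := by
  rcases x with ⟨i, _ | _⟩ <;> simp [letterWeight, invLetter]

lemma invLetter_involutive : Function.Involutive (invLetter (n := n)) := fun x => by
  simp [invLetter]

lemma tailSum_succ (w : Fin n → ℂˣ) (s : ℕ) (x : Fin n × Bool) :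
    tailSum w (s + 1) x
      = charSum w (s + 1) - letterWeight w (invLetter x) * tailSum w s (invLetter x) := by
  have h : tailSum w (s + 1) x
      = ∑ y ∈ univ.filter (fun y : Fin n × Bool => x.1 = y.1 → x.2 = y.2),
        letterWeight w y * tailSum w s y := by
    rw [tailSum, tails, sum_biUnion]
    · simp [tailSum, mul_sum]
    · intro y _ y' _ hyy
      rw [Function.onFun, Finset.disjoint_left]
      intro L hL hL'
      simp only [Finset.mem_map, Function.Embedding.coeFn_mk] at hL hL'
      obtain ⟨_, _, rfl⟩ := hL
      obtain ⟨_, _, h⟩ := hL'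
      simp at h
      exact hyy h.1.symm
  rw [h, charSum_succ, eq_sub_iff_add_eq]
  have : univ.filter (fun y : Fin n × Bool => x.1 = y.1 → x.2 = y.2)
      = univ.erase (invLetter x) := by
    ext ⟨i, b⟩
    rcases x with ⟨j, c⟩
    simp only [mem_filter, mem_univ, true_and, mem_erase, and_true, invLetter, ne_eq,
      Prod.mk.injEq, not_and]
    constructor
    · rintro h rfl rfl
      simp at h
    · rintro h rfl
      have := h rfl
      cases b <;> cases c <;> simp_all
  rw [this, sum_erase_add _ _ (mem_univ _)]

/-- The sum of the values of a character on the generators and their inverses. -/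
noncomputable def letterSum (w : Fin n → ℂˣ) : ℂ := ∑ y, letterWeight w y

lemma charSum_one (w : Fin n → ℂˣ) : charSum w 1 = letterSum w := by
  simp [charSum_succ, tailSum_zero, letterSum]

lemma sum_tailSum_succ (w : Fin n → ℂˣ) (s : ℕ) :
    ∑ x, tailSum w (s + 1) x = (2 * n - 1) * charSum w (s + 1) := by
  simp only [tailSum_succ, sum_sub_distrib]
  rw [(invLetter_involutive (n := n)).bijective.sum_comp
    (fun x => letterWeight w x * tailSum w s x), ← charSum_succ]
  simp
  ring

lemma charSum_succ_succ (w : Fin n → ℂˣ) (s : ℕ) :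
    charSum w (s + 2) = letterSum w * charSum w (s + 1) - ∑ x, tailSum w s x := by
  rw [charSum_succ w (s + 1)]
  simp only [tailSum_succ, mul_sub, sum_sub_distrib, ← mul_assoc, letterWeight_mul_invLetter,
    one_mul, ← sum_mul, letterSum]
  rw [(invLetter_involutive (n := n)).bijective.sum_comp (fun x => tailSum w s x)]

lemma charSum_two (w : Fin n → ℂˣ) : charSum w 2 = letterSum w ^ 2 - 2 * n := by
  rw [charSum_succ_succ, charSum_one]
  simp [tailSum_zero]
  ring

lemma charSum_add_three (w : Fin n → ℂˣ) (s : ℕ) :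
    charSum w (s + 3) = letterSum w * charSum w (s + 2) - (2 * n - 1) * charSum w (s + 1) := by
  rw [charSum_succ_succ, sum_tailSum_succ]

lemma charSum_const_one (s : ℕ) : charSum (1 : Fin n → ℂˣ) s = #(sphere n s) := by
  have : FreeGroup.lift (1 : Fin n → ℂˣ) = 1 := by ext; simp
  simp [charSum, this]

lemma letterSum_const_one : letterSum (1 : Fin n → ℂˣ) = 2 * n := by
  have : ∀ x, letterWeight (1 : Fin n → ℂˣ) x = 1 := by
    rintro ⟨i, _ | _⟩ <;> simp [letterWeight]
  simp [letterSum, this]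
  ring

lemma card_sphere_succ (s : ℕ) : (#(sphere n (s + 1)) : ℝ) = 2 * n * (2 * n - 1) ^ s := by
  have h : ∀ s, (#(sphere n (s + 1)) : ℂ) = 2 * n * (2 * n - 1) ^ s ∧
      (#(sphere n (s + 2)) : ℂ) = 2 * n * (2 * n - 1) ^ (s + 1) := by
    intro s
    induction s with
    | zero =>
      simp only [← charSum_const_one, zero_add, charSum_one, charSum_two, letterSum_const_one]
      constructor <;> ring
    | succ s ih =>
      refine ⟨ih.2, ?_⟩
      rw [← charSum_const_one, charSum_add_three, charSum_const_one, charSum_const_one, ih.1, ih.2,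
        letterSum_const_one]
      ring
  have := (h s).1
  exact_mod_cast this

lemma letterSum_eq (w : Fin n → ℂˣ) : letterSum w = ∑ i, ((w i : ℂ) + (w i : ℂ)⁻¹) := by
  rw [letterSum, Fintype.sum_prod_type]
  simp [letterWeight]

/-! ### Exponent sums -/

/-- The mean over a sphere of the character with generator values `w`. -/
noncomputable def charMean (w : Fin n → ℂˣ) (s : ℕ) : ℂ := charSum w s / #(sphere n s)

lemma card_sphere_pos (hn : 1 ≤ n) (s : ℕ) : 0 < #(sphere n s) := by
  have hn' : (1 : ℝ) ≤ n := by exact_mod_cast hn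
  cases s with
  | zero => exact card_pos.2 ⟨1, by simp⟩
  | succ s =>
    have h : (0 : ℝ) < 2 * n * (2 * n - 1) ^ s := by
      have : (0 : ℝ) < 2 * n - 1 := by linarith
      positivity
    rw [← card_sphere_succ] at h
    exact_mod_cast h

lemma charMean_add_three (hn : 2 ≤ n) (w : Fin n → ℂˣ) {A : ℝ} (hA : letterSum w = A) (s : ℕ) :
    charMean w (s + 3) = ((A / (2 * n - 1) : ℝ) : ℂ) * charMean w (s + 2)
      - ((1 / (2 * n - 1) : ℝ) : ℂ) * charMean w (s + 1) := by
  have hn' : (2 : ℝ) ≤ n := by exact_mod_cast hn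
  have h1 : (2 * n - 1 : ℝ) ≠ 0 := by linarith
  have h0 : (n : ℝ) ≠ 0 := by linarith
  have hc : ∀ s, (#(sphere n (s + 1)) : ℂ) = 2 * n * (2 * n - 1) ^ s := fun s => by
    exact_mod_cast card_sphere_succ (n := n) s
  have h1' : (2 * n - 1 : ℂ) ≠ 0 := by exact_mod_cast h1
  have h0' : (n : ℂ) ≠ 0 := by exact_mod_cast h0
  rw [charMean, charMean, charMean, hc, hc, hc, charSum_add_three, hA]
  push_cast
  field_simp
  ring

lemma charMean_one (w : Fin n → ℂˣ) : charMean w 1 = letterSum w / (2 * n) := by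
  have : (#(sphere n 1) : ℂ) = 2 * n := by
    have h := card_sphere_succ (n := n) 0
    rw [pow_zero, mul_one] at h
    exact_mod_cast congrArg Complex.ofReal h
  rw [charMean, this, charSum_one]

lemma charMean_two (w : Fin n → ℂˣ) :
    charMean w 2 = (letterSum w ^ 2 - 2 * n) / (2 * n * (2 * n - 1)) := by
  have : (#(sphere n 2) : ℂ) = 2 * n * (2 * n - 1) := by
    have h := card_sphere_succ (n := n) 1
    rw [pow_one] at h
    exact_mod_cast congrArg Complex.ofReal h
  rw [charMean, this, charSum_two]

lemma one_div_le_third (hn : 2 ≤ n) : (1 : ℝ) / (2 * n - 1) ≤ 1 / 3 := by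
  have hn' : (2 : ℝ) ≤ n := by exact_mod_cast hn
  exact one_div_le_one_div_of_le (by norm_num) (by linarith)

lemma norm_lift_eq_one {w : Fin n → ℂˣ} (hw : ∀ i, ‖(w i : ℂ)‖ = 1) (f : FreeGroup (Fin n)) :
    ‖(FreeGroup.lift w f : ℂ)‖ = 1 := by
  induction f using FreeGroup.induction_on with
  | C1 => simp
  | of i => simp [hw]
  | inv_of i h => simp [hw]
  | mul x y hx hy => simp [hx, hy]

lemma norm_charMean_le_one (hn : 1 ≤ n) {w : Fin n → ℂˣ} (hw : ∀ i, ‖(w i : ℂ)‖ = 1) (s : ℕ) :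
    ‖charMean w s‖ ≤ 1 := by
  have h0 : (0 : ℝ) < #(sphere n s) := by exact_mod_cast card_sphere_pos hn s
  rw [charMean, norm_div, Complex.norm_natCast, div_le_one h0]
  refine (norm_sum_le _ _).trans ?_
  simp [norm_lift_eq_one hw]

lemma norm_charMean_le_exp (hn : 2 ≤ n) {w : Fin n → ℂˣ} (hw : ∀ i, ‖(w i : ℂ)‖ = 1) {A : ℝ}
    (hA : letterSum w = A) (hA' : |A| ≤ 2 * n) (s : ℕ) :
    ‖charMean w s‖ ≤ 12 * Real.exp (-((2 * n - |A|) / (2 * n - 1)) / 6 * s) := by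
  have hn' : (2 : ℝ) ≤ n := by exact_mod_cast hn
  have h1 : (0 : ℝ) < 2 * n - 1 := by linarith
  cases s with
  | zero => simpa using (norm_charMean_le_one (by omega) hw 0).trans (by norm_num)
  | succ s =>
    have e : 1 + 1 / (2 * (n : ℝ) - 1) - |A / (2 * n - 1)| = (2 * n - |A|) / (2 * n - 1) := by
      rw [abs_div, abs_of_pos h1]; field_simp; ring
    have := norm_le_exp_of_recurrence (a := A / (2 * n - 1)) (b := 1 / (2 * n - 1)) (M := 1)
      (x := fun s => charMean w (s + 1)) (by positivity) (one_div_le_third hn) ?_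
      (charMean_add_three hn w hA) (norm_charMean_le_one (by omega) hw _)
      (norm_charMean_le_one (by omega) hw _) s
    · rw [e] at this
      refine this.trans ?_
      set h := (2 * (n : ℝ) - |A|) / (2 * n - 1) with hh
      have h43 : h ≤ 4 / 3 := by
        rw [hh, div_le_iff₀ h1]
        linarith [abs_nonneg A]
      have e3 : Real.exp (h / 6) ≤ 3 := by
        refine (Real.exp_le_exp.2 (by linarith : h / 6 ≤ 1)).trans ?_
        have := Real.exp_one_lt_d9
        linarith
      have : Real.exp (-h / 6 * s) = Real.exp (h / 6) * Real.exp (-h / 6 * (s + 1 : ℕ)) := by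
        rw [← Real.exp_add]; congr 1; push_cast; ring
      rw [this]
      nlinarith [Real.exp_pos (-h / 6 * (s + 1 : ℕ))]
    · rw [abs_div, abs_of_pos h1, div_le_iff₀ h1]
      field_simp
      linarith

/-- The exponent sums of an element of a free group. -/
def expo (f : FreeGroup (Fin n)) : Fin n → ℤ :=
  (FreeGroup.lift (fun j : Fin n => Multiplicative.ofAdd (Pi.single j (1 : ℤ))) f).toAdd

@[simp] lemma expo_one : expo (1 : FreeGroup (Fin n)) = 0 := by simp [expo]
@[simp] lemma expo_of (i : Fin n) : expo (FreeGroup.of i) = Pi.single i 1 := by simp [expo]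
@[simp] lemma expo_mul (f g : FreeGroup (Fin n)) : expo (f * g) = expo f + expo g := by
  simp [expo]
@[simp] lemma expo_inv (f : FreeGroup (Fin n)) : expo f⁻¹ = -expo f := by simp [expo]

lemma lift_eq_prod_zpow {G : Type*} [CommGroup G] (w : Fin n → G) (f : FreeGroup (Fin n)) :
    FreeGroup.lift w f = ∏ i, w i ^ expo f i := by
  induction f using FreeGroup.induction_on with
  | C1 => simp
  | of i => simp [Pi.single_apply]
  | inv_of i h => simp [h]
  | mul x y hx hy => simp [hx, hy, zpow_add, prod_mul_distrib]

/-- The unit of `ℂ` given by a real exponential. -/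
noncomputable def expUnit (l : ℝ) : ℂˣ := Units.mk0 (Real.exp l : ℂ) (by simp)

lemma exp_half_sq_le {l : ℝ} (hl : l ^ 2 ≤ 1) : Real.cosh l ≤ 1 + l ^ 2 := by
  refine (Real.cosh_le_exp_half_sq l).trans ?_
  have := Real.abs_exp_sub_one_le (x := l ^ 2 / 2)
    (by rw [abs_of_nonneg] <;> nlinarith [sq_nonneg l])
  rw [abs_of_nonneg (by positivity : 0 ≤ l ^ 2 / 2)] at this
  linarith [(abs_le.1 this).2]

lemma sum_exp_le (hn : 2 ≤ n) (i : Fin n) {l : ℝ} {s : ℕ} (hl : l ^ 2 * (s + 1) ≤ 1) :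
    ∑ f ∈ sphere n (s + 1), Real.exp (l * expo f i) ≤ 48 * #(sphere n (s + 1)) := by
  have hn' : (2 : ℝ) ≤ n := by exact_mod_cast hn
  have h1 : (0 : ℝ) < 2 * n - 1 := by linarith
  have hl1 : l ^ 2 ≤ 1 := by nlinarith [sq_nonneg l, (Nat.cast_nonneg s : (0:ℝ) ≤ s)]
  set w : Fin n → ℂˣ := Pi.mulSingle i (expUnit l) with hw
  have hval : ∀ f, (FreeGroup.lift w f : ℂ) = (Real.exp (l * expo f i) : ℝ) := by
    intro f
    rw [lift_eq_prod_zpow, prod_eq_single i]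
    · simp only [hw, Pi.mulSingle_eq_same, expUnit, Units.val_zpow_eq_zpow_val, Units.val_mk0]
      rw [mul_comm]
      push_cast
      rw [Complex.exp_int_mul]
    · intro j _ hj
      simp [hw, Pi.mulSingle_eq_of_ne hj]
    · simp
  have hA : letterSum w = ((2 * n - 2 + 2 * Real.cosh l : ℝ) : ℂ) := by
    rw [letterSum_eq, ← Finset.add_sum_erase _ _ (mem_univ i),
      Finset.sum_congr rfl (g := fun _ => (2 : ℂ))]
    · simp only [hw, Pi.mulSingle_eq_same, expUnit, Units.val_mk0, sum_const,
        card_erase_of_mem (mem_univ i), card_univ, Fintype.card_fin,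
        nsmul_eq_mul]
      rw [Real.cosh_eq, Real.exp_neg]
      push_cast [Nat.cast_sub (by omega : 1 ≤ n)]
      ring
    · intro j hj
      simp [hw, Pi.mulSingle_eq_of_ne (ne_of_mem_erase hj)]
      norm_num
  set η := 2 * (Real.cosh l - 1) with hη
  have hη0 : 0 ≤ η := by have := Real.one_le_cosh l; linarith
  have hη1 : η ≤ 2 * l ^ 2 := by have := exp_half_sq_le hl1; linarith
  have hA2 : letterSum w = ((2 * n + η : ℝ) : ℂ) := by rw [hA, hη]; congr 1; ring
  have b3 := one_div_le_third hn
  have hbpos : (0 : ℝ) ≤ 1 / (2 * n - 1) := by positivity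
  have main := norm_le_of_recurrence (b := 1 / (2 * n - 1)) (h := -(η / (2 * n - 1)))
    (ρ := 1 + 2 * (η / (2 * n - 1))) (M := 3)
    (x := fun s => charMean w (s + 1)) (by positivity) b3 ?_ ?_ ?_ ?_ ?_ s
  · have hexp : (1 + 2 * (η / (2 * n - 1))) ^ s ≤ 4 := by
      have a1 : 1 + 2 * (η / (2 * n - 1)) ≤ Real.exp (2 * (η / (2 * n - 1))) := by
        have := Real.add_one_le_exp (2 * (η / (2 * n - 1))); linarith
      have a2 : (1 + 2 * (η / (2 * n - 1))) ^ s ≤ Real.exp (4 / 3) := by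
        refine (pow_le_pow_left₀ (by positivity) a1 s).trans ?_
        rw [← Real.exp_nat_mul, Real.exp_le_exp]
        have : η / (2 * n - 1) ≤ 1 / 3 * (2 * l ^ 2) := by
          calc η / (2 * n - 1) = 1 / (2 * n - 1) * η := by ring
            _ ≤ _ := by gcongr
        have hs : (s : ℝ) * (η / (2 * n - 1)) ≤ s * (1 / 3 * (2 * l ^ 2)) := by gcongr
        nlinarith [sq_nonneg l]
      refine a2.trans ?_
      have a3 : Real.exp (4 / 3) ^ 3 ≤ 4 ^ 3 := by
        rw [← Real.exp_nat_mul]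
        have : ((3 : ℕ) : ℝ) * (4 / 3) = (4 : ℕ) * 1 := by norm_num
        rw [this, Real.exp_nat_mul]
        calc Real.exp 1 ^ 4 ≤ 2.7182818286 ^ 4 := by
              gcongr; exact Real.exp_one_lt_d9.le
          _ ≤ _ := by norm_num
      exact le_of_pow_le_pow_left₀ (by norm_num) (by norm_num) a3
    have m2 : ‖charMean w (s + 1)‖ ≤ 48 := main.trans (by linarith)
    have hc : (0 : ℝ) < #(sphere n (s + 1)) := by exact_mod_cast card_sphere_pos (by omega) _
    rw [charMean, norm_div, Complex.norm_natCast, div_le_iff₀ hc, charSum] at m2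
    simp only [hval] at m2
    rw [← Complex.ofReal_sum, Complex.norm_real] at m2
    exact (le_abs_self _).trans m2
  · have hh : 0 ≤ η / (2 * n - 1) := by positivity
    rw [abs_neg, abs_of_nonneg hh, abs_of_nonneg (by linarith)]
    nlinarith
  · have hh : 0 ≤ η / (2 * n - 1) := by positivity
    linarith
  · intro s
    rw [charMean_add_three hn w hA2]
    congr 3
    field_simp; ring
  · show ‖charMean w 1‖ ≤ 3
    rw [charMean_one, hA2]
    rw [show ((2 * n + η : ℝ) : ℂ) / (2 * n) = (((2 * n + η) / (2 * n) : ℝ) : ℂ) by push_cast; rfl,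
      Complex.norm_real, Real.norm_of_nonneg (by positivity), div_le_iff₀ (by positivity)]
    linarith
  · show ‖charMean w 2‖ ≤ 3
    rw [charMean_two, hA2]
    rw [show (((2 * n + η : ℝ) : ℂ) ^ 2 - 2 * n) / (2 * n * (2 * n - 1))
      = ((((2 * n + η) ^ 2 - 2 * n) / (2 * n * (2 * n - 1)) : ℝ) : ℂ) by push_cast; rfl,
      Complex.norm_real, Real.norm_of_nonneg, div_le_iff₀ (by positivity)]
    · have : η ≤ 2 := by linarith
      nlinarith
    · apply div_nonneg _ (by positivity)
      nlinarith

/-- Large exponent sums are rare. -/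
lemma card_large_expo_mul_le (hn : 2 ≤ n) (i : Fin n) (s : ℕ) :
    (#{f ∈ sphere n s | s ^ 2 < |expo f i| ^ 3} : ℝ) * s ≤ 69120 * #(sphere n s) := by
  cases s with
  | zero => simp
  | succ s =>
    set l : ℝ := 1 / √(s + 1 : ℝ) with hl
    have hsp : (0 : ℝ) < s + 1 := by positivity
    have hl2 : l ^ 2 * (s + 1) = 1 := by
      rw [hl, div_pow, Real.sq_sqrt hsp.le]; field_simp
    have b1 := sum_exp_le hn i hl2.le
    have b2 := sum_exp_le hn i (l := -l) (by rw [neg_sq]; exact hl2.le)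
    have key : ∀ f ∈ sphere n (s + 1),
        (if ((s + 1 : ℕ) : ℤ) ^ 2 < |expo f i| ^ 3 then (s + 1 : ℝ) else 0)
        ≤ 720 * (Real.exp (l * expo f i) + Real.exp (-l * expo f i)) := by
      intro f _
      split_ifs with h
      · have h' : ((s : ℝ) + 1) ^ 2 < |(expo f i : ℝ)| ^ 3 := by exact_mod_cast h
        have h6 : ((s : ℝ) + 1) ^ 4 ≤ (expo f i : ℝ) ^ 6 := by
          calc ((s : ℝ) + 1) ^ 4 = (((s : ℝ) + 1) ^ 2) ^ 2 := by ring
            _ ≤ (|(expo f i : ℝ)| ^ 3) ^ 2 := by gcongr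
            _ = (|(expo f i : ℝ)| ^ 2) ^ 3 := by ring
            _ = _ := by rw [sq_abs]; ring
        have e1 := Real.pow_div_factorial_le_exp _ (abs_nonneg (l * expo f i)) 6
        have e2 : Real.exp |l * expo f i| ≤ Real.exp (l * expo f i) + Real.exp (-l * expo f i) := by
          rcases abs_cases (l * (expo f i : ℝ)) with ⟨h, _⟩ | ⟨h, _⟩ <;> rw [h]
          · linarith [Real.exp_pos (-l * expo f i)]
          · rw [neg_mul]; linarith [Real.exp_pos (l * expo f i)]
        have e3 : |l * (expo f i : ℝ)| ^ 6 = (l ^ 2) ^ 3 * (expo f i : ℝ) ^ 6 := by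
          rw [show (6 : ℕ) = 2 * 3 by rfl, pow_mul, sq_abs]; ring
        have e4 : (s + 1 : ℝ) = (l ^ 2) ^ 3 * ((s : ℝ) + 1) ^ 4 := by
          calc (s + 1 : ℝ) = (l ^ 2 * (s + 1)) ^ 3 * (s + 1) := by rw [hl2]; ring
            _ = _ := by ring
        have e5 : (s + 1 : ℝ) ≤ |l * (expo f i : ℝ)| ^ 6 := by
          rw [e3, e4]; gcongr
        have : ((Nat.factorial 6 : ℕ) : ℝ) = 720 := by norm_num [Nat.factorial]
        rw [this] at e1
        linarith
      · positivity
    have := Finset.sum_le_sum key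
    rw [← mul_sum, sum_add_distrib, ← sum_filter, sum_const, nsmul_eq_mul] at this
    push_cast at this ⊢
    linarith

/-! ### Equidistribution of the exponent sums -/

/-- The generator values of the character of `F_n` attached to a vector over `ZMod d`. -/
noncomputable def zmodWeight {d : ℕ} [NeZero d] (j : Fin n → ZMod d) (i : Fin n) : ℂˣ :=
  Circle.toUnits (ZMod.toCircle (j i))

@[simp] lemma coe_zmodWeight {d : ℕ} [NeZero d] (j : Fin n → ZMod d) (i : Fin n) :
    (zmodWeight j i : ℂ) = ZMod.stdAddChar (j i) := rfl

lemma norm_stdAddChar {d : ℕ} [NeZero d] (a : ZMod d) : ‖(ZMod.stdAddChar a : ℂ)‖ = 1 := by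
  rw [ZMod.stdAddChar_apply, Circle.norm_coe]

/-- The number of points of a sphere whose exponent sums are all divisible by `d`. -/
noncomputable def divCount (n d s : ℕ) : ℕ := #{f ∈ sphere n s | ∀ i, (d : ℤ) ∣ expo f i}

/-- The proportion of points of a sphere whose exponent sums are all divisible by `d`. -/
noncomputable def divDensity (n d s : ℕ) : ℝ := divCount n d s / #(sphere n s)

lemma sum_lift_zmodWeight {d : ℕ} [NeZero d] (f : FreeGroup (Fin n)) :
    ∑ j : Fin n → ZMod d, (FreeGroup.lift (zmodWeight j) f : ℂ)
      = if ∀ i, (d : ℤ) ∣ expo f i then (d : ℂ) ^ n else 0 := by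
  have h1 : ∀ j : Fin n → ZMod d, (FreeGroup.lift (zmodWeight j) f : ℂ)
      = ∏ i, (ZMod.stdAddChar (j i * (expo f i : ZMod d)) : ℂ) := by
    intro j
    rw [lift_eq_prod_zpow, Units.coe_prod]
    refine prod_congr rfl fun i _ => ?_
    rw [Units.val_zpow_eq_zpow_val, coe_zmodWeight, mul_comm, ← zsmul_eq_mul,
      AddChar.map_zsmul_eq_zpow]
  simp only [h1]
  have h2 := Finset.prod_univ_sum (fun _ : Fin n => (univ : Finset (ZMod d)))
    (fun i a => (ZMod.stdAddChar (a * (expo f i : ZMod d)) : ℂ))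
  rw [Fintype.piFinset_univ] at h2
  rw [← h2]
  simp only [AddChar.sum_mulShift _ (ZMod.isPrimitive_stdAddChar d), ZMod.card,
    ZMod.intCast_zmod_eq_zero_iff_dvd]
  split_ifs with h
  · simp [h]
  · push Not at h
    obtain ⟨i, hi⟩ := h
    exact prod_eq_zero (mem_univ i) (by simp [hi])

lemma divDensity_eq {d : ℕ} [NeZero d] (s : ℕ) :
    (divDensity n d s : ℂ) = (∑ j : Fin n → ZMod d, charMean (zmodWeight j) s) / (d : ℂ) ^ n := by
  have hd : (d : ℂ) ≠ 0 := by exact_mod_cast NeZero.ne d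
  simp only [charMean, ← sum_div, charSum]
  rw [sum_comm]
  simp only [sum_lift_zmodWeight]
  rw [← sum_filter, sum_const, nsmul_eq_mul, divDensity, divCount]
  push_cast
  field_simp

lemma letterSum_zmodWeight {d : ℕ} [NeZero d] (j : Fin n → ZMod d) :
    letterSum (zmodWeight j) = ((∑ i, 2 * (ZMod.stdAddChar (j i) : ℂ).re : ℝ) : ℂ) := by
  rw [letterSum_eq]
  push_cast
  refine sum_congr rfl fun i _ => ?_
  rw [coe_zmodWeight, Complex.inv_eq_conj (norm_stdAddChar _), Complex.add_conj]
  push_cast; rfl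

lemma abs_re_stdAddChar_le {d : ℕ} [NeZero d] (a : ZMod d) :
    |(ZMod.stdAddChar a : ℂ).re| ≤ 1 := (Complex.abs_re_le_norm _).trans (norm_stdAddChar a).le

lemma abs_sum_re_le {d : ℕ} [NeZero d] (j : Fin n → ZMod d) :
    |∑ i, 2 * (ZMod.stdAddChar (j i) : ℂ).re| + ∑ i, (ZMod.stdAddChar (j i) : ℂ).im ^ 2
      ≤ 2 * n := by
  calc _ ≤ ∑ i, |2 * (ZMod.stdAddChar (j i) : ℂ).re| + ∑ i, (ZMod.stdAddChar (j i) : ℂ).im ^ 2 := by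
        gcongr; exact abs_sum_le_sum_abs _ _
    _ = ∑ i, (|2 * (ZMod.stdAddChar (j i) : ℂ).re| + (ZMod.stdAddChar (j i) : ℂ).im ^ 2) := by
        rw [sum_add_distrib]
    _ ≤ ∑ i : Fin n, 2 := by
        refine sum_le_sum fun i _ => ?_
        have h1 := Complex.sq_norm (ZMod.stdAddChar (j i))
        rw [norm_stdAddChar, Complex.normSq_apply] at h1
        rw [abs_mul, abs_two]
        nlinarith [sq_abs (ZMod.stdAddChar (j i) : ℂ).re,
          sq_nonneg (1 - |(ZMod.stdAddChar (j i) : ℂ).re|)]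
    _ = 2 * n := by simp [mul_comm]

lemma norm_charMean_zmodWeight_le (hn : 2 ≤ n) {d : ℕ} [NeZero d] (j : Fin n → ZMod d) (s : ℕ) :
    ‖charMean (zmodWeight j) s‖
      ≤ 12 * ∏ i, Real.exp (-(s / (6 * (2 * n - 1))) * (ZMod.stdAddChar (j i) : ℂ).im ^ 2) := by
  have hn' : (2 : ℝ) ≤ n := by exact_mod_cast hn
  have h1 : (0 : ℝ) < 2 * n - 1 := by linarith
  have h := abs_sum_re_le j
  refine (norm_charMean_le_exp hn (w := zmodWeight j) (fun i => norm_stdAddChar _)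
    (letterSum_zmodWeight j) ?_ s).trans ?_
  · have : 0 ≤ ∑ i, (ZMod.stdAddChar (j i) : ℂ).im ^ 2 := by positivity
    linarith
  · rw [← Real.exp_sum]
    have h2 : ∑ i, (ZMod.stdAddChar (j i) : ℂ).im ^ 2
      ≤ 2 * n - |∑ i, 2 * (ZMod.stdAddChar (j i) : ℂ).re| := by linarith
    gcongr
    have h3 := mul_le_mul_of_nonneg_left h2 (by positivity : (0 : ℝ) ≤ s / (6 * (2 * n - 1)))
    have h4 : -((2 * n - |∑ i, 2 * (ZMod.stdAddChar (j i) : ℂ).re|) / (2 * n - 1)) / 6 * (s : ℝ)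
      = - (s / (6 * (2 * n - 1)) * (2 * n - |∑ i, 2 * (ZMod.stdAddChar (j i) : ℂ).re|)) := by
      field_simp
    rw [h4]
    refine (neg_le_neg h3).trans_eq ?_
    simp only [mul_sum, neg_mul, sum_neg_distrib]

lemma sum_pow_le_of_injOn {ι : Type*} (S : Finset ι) (φ : ι → ℕ) (hφ : Set.InjOn φ S) {r : ℝ}
    (hr0 : 0 ≤ r) (hr : r < 1) : ∑ a ∈ S, r ^ φ a ≤ (1 - r)⁻¹ := by
  classical
  rw [← Finset.sum_image (f := fun m => r ^ m) (g := φ) hφ, ← tsum_geometric_of_lt_one hr0 hr]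
  exact (summable_geometric_of_lt_one hr0 hr).sum_le_tsum _ fun m _ => by positivity

lemma sum_pow_natAbs_le (d : ℕ) (c : ℤ) {r : ℝ} (hr0 : 0 ≤ r) (hr : r < 1) :
    ∑ a ∈ range d, r ^ (2 * (a : ℤ) - c).natAbs ≤ 2 * (1 - r)⁻¹ := by
  rw [← sum_filter_add_sum_filter_not (range d) (fun a : ℕ => c ≤ 2 * (a : ℤ)), two_mul]
  refine add_le_add (sum_pow_le_of_injOn _ _ ?_ hr0 hr) (sum_pow_le_of_injOn _ _ ?_ hr0 hr)
  · intro a ha b hb h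
    simp only [coe_filter, mem_range, Set.mem_ofPred_eq] at ha hb h
    omega
  · intro a ha b hb h
    simp only [coe_filter, mem_range, Set.mem_ofPred_eq] at ha hb h
    omega

lemma im_stdAddChar {d : ℕ} [NeZero d] (a : ℕ) :
    (ZMod.stdAddChar (a : ZMod d) : ℂ).im = Real.sin (2 * Real.pi * a / d) := by
  have := ZMod.stdAddChar_coe (N := d) a
  rw [Int.cast_natCast] at this
  rw [this]
  have : 2 * (Real.pi : ℂ) * Complex.I * (a : ℤ) / d
      = ((2 * Real.pi * a / d : ℝ) : ℂ) * Complex.I := by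
    push_cast; ring
  rw [this, Complex.exp_ofReal_mul_I_im]

/-- Jordan's inequality, relative to the nearest zero of the sine. -/
lemma exists_sq_sub_le_sin_sq {x : ℝ} (hx0 : 0 ≤ x) (hx2 : x ≤ 2) :
    ∃ z ∈ range 3, 4 * (x - z) ^ 2 ≤ Real.sin (Real.pi * x) ^ 2 := by
  have key : ∀ (z : ℕ), |x - z| ≤ 1 / 2 → 4 * (x - z) ^ 2 ≤ Real.sin (Real.pi * x) ^ 2 := by
    intro z hz
    have hpi := Real.pi_pos
    have h1 := Real.mul_abs_le_abs_sin (x := Real.pi * (x - z)) (by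
      rw [abs_mul, abs_of_pos hpi]; nlinarith)
    have h2 : |Real.sin (Real.pi * (x - z))| = |Real.sin (Real.pi * x)| := by
      rw [mul_sub, mul_comm Real.pi (z : ℝ), Real.sin_sub_nat_mul_pi, abs_mul, abs_pow, abs_neg,
        abs_one, one_pow, one_mul]
    rw [h2, abs_mul, abs_of_pos hpi] at h1
    have h3 : 2 * |x - z| ≤ |Real.sin (Real.pi * x)| := by
      refine le_of_eq_of_le ?_ h1
      field_simp
    rw [← sq_abs (Real.sin _), ← sq_abs (x - z)]
    nlinarith [abs_nonneg (x - z)]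
  rcases le_or_gt x (1 / 2) with h | h
  · exact ⟨0, by simp, key 0 (by rw [abs_le]; constructor <;> norm_num <;> linarith)⟩
  rcases le_or_gt x (3 / 2) with h' | h'
  · exact ⟨1, by simp, key 1 (by rw [abs_le]; constructor <;> norm_num <;> linarith)⟩
  · exact ⟨2, by simp, key 2 (by rw [abs_le]; constructor <;> norm_num <;> linarith)⟩

lemma sum_exp_im_sq_le {d : ℕ} [NeZero d] {t : ℝ} (ht : 0 < t) :
    ∑ a : ZMod d, Real.exp (-t * (ZMod.stdAddChar a : ℂ).im ^ 2) ≤ 18 * (1 + d / √t) := by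
  have hd : (0 : ℝ) < d := by exact_mod_cast NeZero.pos d
  have hst : 0 < √t := Real.sqrt_pos.2 ht
  set l : ℝ := 2 * √t / d with hl
  have hl0 : 0 < l := by positivity
  set r : ℝ := Real.exp (-(2 * l)) with hr
  have hr0 : 0 ≤ r := by positivity
  have hr1 : r < 1 := by rw [hr, Real.exp_lt_one_iff]; linarith
  have hinv : (1 - r)⁻¹ ≤ 1 + d / √t := by
    have e1 : r ≤ (1 + 2 * l)⁻¹ := by
      rw [hr, Real.exp_neg]
      have := Real.add_one_le_exp (2 * l)
      gcongr; linarith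
    have e2 : 1 - (1 + 2 * l)⁻¹ = 2 * l / (1 + 2 * l) := by field_simp; ring
    have e3 : 2 * l / (1 + 2 * l) ≤ 1 - r := by linarith
    have e4 : (1 - r)⁻¹ ≤ (2 * l / (1 + 2 * l))⁻¹ := by gcongr
    refine e4.trans ?_
    have e5 : (2 * l / (1 + 2 * l))⁻¹ = 1 + d / √t / 4 := by
      rw [hl]; field_simp; ring
    rw [e5]
    have : 0 ≤ d / √t := by positivity
    linarith
  have hsum : ∑ a : ZMod d, Real.exp (-t * (ZMod.stdAddChar a : ℂ).im ^ 2)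
      = ∑ a ∈ range d, Real.exp (-t * Real.sin (Real.pi * (2 * a / d)) ^ 2) := by
    refine sum_bij' (fun a _ => a.val) (fun a _ => (a : ZMod d)) ?_ ?_ ?_ ?_ ?_
    · intro a _; simp [ZMod.val_lt]
    · simp
    · simp
    · intro a ha; exact ZMod.val_cast_of_lt (mem_range.1 ha)
    · intro a _
      have := im_stdAddChar (d := d) a.val
      rw [ZMod.natCast_zmod_val] at this
      rw [this]
      congr 4; ring
  rw [hsum]
  have hpt : ∀ a ∈ range d, Real.exp (-t * Real.sin (Real.pi * (2 * a / d)) ^ 2)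
      ≤ ∑ z ∈ range 3, 3 * r ^ (2 * (a : ℤ) - z * d).natAbs := by
    intro a ha
    have had : (a : ℝ) ≤ d := by exact_mod_cast (mem_range.1 ha).le
    obtain ⟨z, hz, hz'⟩ := exists_sq_sub_le_sin_sq (x := 2 * a / d) (by positivity)
      (by rw [div_le_iff₀ hd]; linarith)
    refine le_trans ?_ (single_le_sum (f := fun z : ℕ => 3 * r ^ (2 * (a : ℤ) - z * d).natAbs)
      (fun z _ => by positivity) hz)
    set m : ℕ := (2 * (a : ℤ) - z * d).natAbs with hm
    have hm2 : (m : ℝ) ^ 2 = (2 * a - z * d) ^ 2 := by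
      have : ((m : ℕ) : ℤ) ^ 2 = (2 * (a : ℤ) - z * d) ^ 2 := by rw [hm, Int.natCast_natAbs, sq_abs]
      exact_mod_cast this
    have h1 : (l * m) ^ 2 ≤ t * Real.sin (Real.pi * (2 * a / d)) ^ 2 := by
      have : (l * m) ^ 2 = t * (4 * (2 * a / d - z) ^ 2) := by
        rw [mul_pow, hm2, hl, div_pow, mul_pow, Real.sq_sqrt ht.le]; field_simp; ring
      rw [this]; gcongr
    have h2 : Real.exp (-t * Real.sin (Real.pi * (2 * a / d)) ^ 2)
        ≤ Real.exp (1 + m * (-(2 * l))) := by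
      rw [Real.exp_le_exp]
      nlinarith [sq_nonneg (l * m - 1)]
    rw [Real.exp_add, Real.exp_nat_mul] at h2
    refine h2.trans ?_
    have : Real.exp 1 ≤ 3 := by have := Real.exp_one_lt_d9; linarith
    gcongr
  refine (sum_le_sum hpt).trans ?_
  rw [sum_comm]
  have hz : ∀ z ∈ range 3, ∑ a ∈ range d, 3 * r ^ (2 * (a : ℤ) - z * d).natAbs
      ≤ 3 * (2 * (1 + d / √t)) := by
    intro z _
    rw [← mul_sum]
    have := sum_pow_natAbs_le d (z * d) hr0 hr1
    gcongr
    linarith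
  refine (sum_le_sum hz).trans ?_
  simp only [sum_const, card_range, nsmul_eq_mul]
  push_cast
  linarith

lemma divDensity_nonneg (n d s : ℕ) : 0 ≤ divDensity n d s := by unfold divDensity; positivity

lemma exists_divDensity_le (hn : 2 ≤ n) :
    ∃ C : ℝ, 0 ≤ C ∧ ∀ d s : ℕ, 0 < d → 0 < s →
      divDensity n d s ≤ C * (1 / d + 1 / √(s : ℝ)) ^ n := by
  have hn' : (2 : ℝ) ≤ n := by exact_mod_cast hn
  have h1 : (0 : ℝ) < 2 * n - 1 := by linarith
  set k : ℝ := √(6 * (2 * n - 1)) with hk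
  have hk1 : 1 ≤ k := by rw [hk, Real.one_le_sqrt]; linarith
  refine ⟨12 * (18 * k) ^ n, by positivity, ?_⟩
  intro d s hd hs
  have : NeZero d := ⟨hd.ne'⟩
  have hd' : (0 : ℝ) < d := by exact_mod_cast hd
  have hs' : (0 : ℝ) < s := by exact_mod_cast hs
  set t : ℝ := s / (6 * (2 * n - 1)) with ht
  have ht0 : 0 < t := by positivity
  have hst : √t = √(s : ℝ) / k := by rw [ht, Real.sqrt_div hs'.le]
  have hss : 0 < √(s : ℝ) := Real.sqrt_pos.2 hs'
  have e1 : divDensity n d s = ‖(divDensity n d s : ℂ)‖ := by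
    rw [Complex.norm_real, Real.norm_of_nonneg (divDensity_nonneg _ _ _)]
  rw [e1, divDensity_eq, norm_div, norm_pow, Complex.norm_natCast, div_le_iff₀ (by positivity)]
  refine (norm_sum_le _ _).trans ((sum_le_sum fun j _ =>
    norm_charMean_zmodWeight_le hn j s).trans ?_)
  rw [← mul_sum]
  have h2 := Finset.prod_univ_sum (fun _ : Fin n => (univ : Finset (ZMod d)))
    (fun _ a => Real.exp (-t * (ZMod.stdAddChar a : ℂ).im ^ 2))
  rw [Fintype.piFinset_univ] at h2
  rw [← h2, prod_const, card_univ, Fintype.card_fin]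
  have h3 : ∑ a : ZMod d, Real.exp (-t * (ZMod.stdAddChar a : ℂ).im ^ 2)
      ≤ 18 * k * (1 / d + 1 / √(s : ℝ)) * d := by
    refine (sum_exp_im_sq_le ht0).trans ?_
    rw [hst]
    have : 18 * k * (1 / d + 1 / √(s : ℝ)) * d = 18 * (k + d / (√(s : ℝ) / k)) := by
      field_simp
    rw [this]
    gcongr
  calc 12 * (∑ a : ZMod d, Real.exp (-t * (ZMod.stdAddChar a : ℂ).im ^ 2)) ^ n
      ≤ 12 * (18 * k * (1 / d + 1 / √(s : ℝ)) * d) ^ n := by gcongr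
    _ = _ := by rw [mul_pow _ (d : ℝ), mul_pow (18 * k)]; ring

lemma stdAddChar_eq_one_iff {d : ℕ} [NeZero d] (a : ZMod d) :
    (ZMod.stdAddChar a : ℂ) = 1 ↔ a = 0 := by
  rw [← AddChar.map_zero_eq_one (ZMod.stdAddChar (N := d)), ZMod.injective_stdAddChar.eq_iff]

lemma stdAddChar_half {d : ℕ} [NeZero d] (hd : Even d) :
    (ZMod.stdAddChar ((d / 2 : ℕ) : ZMod d) : ℂ) = -1 := by
  have := ZMod.stdAddChar_coe (N := d) (d / 2 : ℕ)
  rw [Int.cast_natCast] at this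
  rw [this, ← Complex.exp_pi_mul_I]
  obtain ⟨m, rfl⟩ := hd
  have hm : (m : ℂ) ≠ 0 := by
    have := NeZero.ne (m + m)
    have : m ≠ 0 := by omega
    exact_mod_cast this
  congr 1
  rw [show (m + m) / 2 = m by omega]
  push_cast
  field_simp
  ring

lemma stdAddChar_ne_neg_one {d : ℕ} [NeZero d] (hd : ¬ Even d) (a : ZMod d) :
    (ZMod.stdAddChar a : ℂ) ≠ -1 := by
  intro h
  have h1 : (ZMod.stdAddChar (d • a) : ℂ) = (-1) ^ d := by
    rw [AddChar.map_nsmul_eq_pow, h]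
  rw [(Nat.not_even_iff_odd.1 hd).neg_one_pow] at h1
  simp at h1
  norm_num at h1

lemma charMean_const_neg_one (hn : 1 ≤ n) {w : Fin n → ℂˣ} (hw : ∀ i, (w i : ℂ) = -1) (s : ℕ) :
    charMean w s = (-1) ^ s := by
  have h0 : (#(sphere n s) : ℂ) ≠ 0 := by exact_mod_cast (card_sphere_pos hn s).ne'
  have hl : letterWeight w = fun _ => -1 := by
    funext ⟨i, b⟩
    cases b <;> simp [letterWeight, hw]
  rw [charMean, charSum, div_eq_iff h0, sum_congr rfl (g := fun _ => (-1) ^ s)]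
  · simp [mul_comm]
  · intro f hf
    rw [← FreeGroup.mk_toWord (x := f), coe_lift_mk, hl, List.map_const', List.prod_replicate,
      mem_sphere.1 hf]

lemma charMean_const_one (hn : 1 ≤ n) {w : Fin n → ℂˣ} (hw : ∀ i, (w i : ℂ) = 1) (s : ℕ) :
    charMean w s = 1 := by
  have h0 : (#(sphere n s) : ℂ) ≠ 0 := by exact_mod_cast (card_sphere_pos hn s).ne'
  have : w = 1 := by ext i; simp [hw]
  rw [charMean, this, charSum_const_one, div_self h0]

lemma eq_of_re_eq {z : ℂ} (hz : ‖z‖ = 1) {c : ℝ} (hc : c ^ 2 = 1) (h : z.re = c) : z = c := by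
  have h1 := Complex.sq_norm z
  rw [hz, Complex.normSq_apply, h] at h1
  apply Complex.ext
  · simpa using h
  · have : z.im = 0 := by
      have : z.im * z.im = 0 := by nlinarith
      simpa using this
    simp [this]

lemma tendsto_charMean_zmodWeight (hn : 2 ≤ n) {d : ℕ} [NeZero d] (j : Fin n → ZMod d) (ε : ℕ) :
    Tendsto (fun m : ℕ => charMean (zmodWeight j) (2 * m + ε)) atTop
      (𝓝 ((if ∀ i, (ZMod.stdAddChar (j i) : ℂ) = 1 then 1 else 0)
        + if ∀ i, (ZMod.stdAddChar (j i) : ℂ) = -1 then (-1) ^ ε else 0)) := by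
  have i0 : Fin n := ⟨0, by omega⟩
  by_cases h1 : ∀ i, (ZMod.stdAddChar (j i) : ℂ) = 1
  · rw [if_pos h1, if_neg (fun h => by have := (h1 i0).symm.trans (h i0); norm_num at this)]
    simp [charMean_const_one (by omega : 1 ≤ n) (w := zmodWeight j) h1]
  by_cases h2 : ∀ i, (ZMod.stdAddChar (j i) : ℂ) = -1
  · rw [if_pos h2, if_neg h1]
    simp [charMean_const_neg_one (by omega : 1 ≤ n) (w := zmodWeight j) h2, pow_add, pow_mul]
  rw [if_neg h1, if_neg h2, add_zero]
  have hn' : (2 : ℝ) ≤ n := by exact_mod_cast hn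
  have hq : (0 : ℝ) < 2 * n - 1 := by linarith
  have hA : |∑ i, 2 * (ZMod.stdAddChar (j i) : ℂ).re| < 2 * n := by
    push Not at h1 h2
    obtain ⟨a, ha⟩ := h1
    obtain ⟨b, hb⟩ := h2
    have hc : (2 * n : ℝ) = ∑ i : Fin n, 2 := by simp [mul_comm]
    rw [hc, abs_lt, ← sum_neg_distrib]
    have hle := fun i => abs_le.1 (abs_re_stdAddChar_le (j i))
    constructor
    · refine sum_lt_sum (fun i _ => by linarith [(hle i).1]) ⟨b, mem_univ _, ?_⟩
      have : (ZMod.stdAddChar (j b) : ℂ).re ≠ -1 := fun h => hb (by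
        simpa using eq_of_re_eq (norm_stdAddChar (j b)) (c := -1) (by norm_num) h)
      have := lt_of_le_of_ne (hle b).1 this.symm
      linarith
    · refine sum_lt_sum (fun i _ => by linarith [(hle i).2]) ⟨a, mem_univ _, ?_⟩
      have : (ZMod.stdAddChar (j a) : ℂ).re ≠ 1 := fun h => ha (by
        simpa using eq_of_re_eq (norm_stdAddChar (j a)) (c := 1) (by norm_num) h)
      have := lt_of_le_of_ne (hle a).2 this
      linarith
  rw [tendsto_zero_iff_norm_tendsto_zero]
  refine squeeze_zero (fun _ => norm_nonneg _) (fun m => norm_charMean_le_exp hn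
    (w := zmodWeight j) (fun i => norm_stdAddChar _) (letterSum_zmodWeight j) hA.le (2 * m + ε)) ?_
  rw [← mul_zero (12 : ℝ)]
  refine Tendsto.const_mul _ (Real.tendsto_exp_atBot.comp ?_)
  refine Tendsto.const_mul_atTop_of_neg ?_ ?_
  · have : 0 < (2 * n - |∑ i, 2 * (ZMod.stdAddChar (j i) : ℂ).re|) / (2 * n - 1) :=
      div_pos (by linarith) hq
    linarith
  · refine tendsto_natCast_atTop_atTop.comp ?_
    exact tendsto_atTop_mono (fun m => by omega : ∀ m : ℕ, m ≤ 2 * m + ε) tendsto_id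

/-- Equidistribution of the exponent sums modulo `d`, along radii of fixed parity. -/
lemma tendsto_divDensity (hn : 2 ≤ n) {d : ℕ} (hd : 0 < d) (ε : ℕ) :
    Tendsto (fun m : ℕ => divDensity n d (2 * m + ε)) atTop
      (𝓝 ((1 + if Even d then (-1) ^ ε else 0) / (d : ℝ) ^ n)) := by
  have : NeZero d := ⟨hd.ne'⟩
  have h := (tendsto_finsetSum univ fun (j : Fin n → ZMod d) _ =>
    tendsto_charMean_zmodWeight hn j ε).div_const ((d : ℂ) ^ n)
  simp only [← divDensity_eq] at h
  have hre := (Complex.continuous_re.tendsto _).comp h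
  have e : (∑ j : Fin n → ZMod d, ((if ∀ i, (ZMod.stdAddChar (j i) : ℂ) = 1 then (1 : ℂ) else 0)
        + if ∀ i, (ZMod.stdAddChar (j i) : ℂ) = -1 then (-1) ^ ε else 0)) / (d : ℂ) ^ n
      = (((1 + if Even d then (-1) ^ ε else 0) / (d : ℝ) ^ n : ℝ) : ℂ) := by
    rw [sum_add_distrib]
    have e1 : ∀ j : Fin n → ZMod d, (∀ i, (ZMod.stdAddChar (j i) : ℂ) = 1) ↔ j = 0 := by
      intro j
      simp only [stdAddChar_eq_one_iff, funext_iff, Pi.zero_apply]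
    simp only [e1, sum_ite_eq', mem_univ, if_true]
    by_cases he : Even d
    · have e2 : ∀ j : Fin n → ZMod d, (∀ i, (ZMod.stdAddChar (j i) : ℂ) = -1) ↔
          j = fun _ => ((d / 2 : ℕ) : ZMod d) := by
        intro j
        simp only [← stdAddChar_half he, ZMod.injective_stdAddChar.eq_iff, funext_iff]
      simp [e2, he]
    · have e2 : ∀ j : Fin n → ZMod d, ¬ (∀ i, (ZMod.stdAddChar (j i) : ℂ) = -1) :=
        fun j h => stdAddChar_ne_neg_one he _ (h ⟨0, by omega⟩)
      simp [e2, he]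
  rwa [e, Complex.ofReal_re] at hre

/-! ### The Möbius sum -/

lemma summable_moebius_div_pow (hn : 2 ≤ n) :
    Summable fun d : ℕ => (ArithmeticFunction.moebius d : ℝ) / (d : ℝ) ^ n := by
  refine Summable.of_norm_bounded (Real.summable_one_div_nat_pow.2 (by omega : 1 < n)) fun d => ?_
  rw [norm_div, norm_pow, Real.norm_natCast]
  gcongr
  rw [Real.norm_eq_abs]
  exact_mod_cast ArithmeticFunction.abs_moebius_le_one (n := d)

lemma zetaR_eq_tsum (hn : 2 ≤ n) : zetaR n = ∑' d : ℕ, 1 / (d : ℝ) ^ n := by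
  rw [(Real.summable_one_div_nat_pow.2 (by omega : 1 < n)).tsum_eq_zero_add, zetaR]
  simp [show n ≠ 0 by omega]

lemma zetaR_mul_tsum_moebius (hn : 2 ≤ n) :
    zetaR n * ∑' d : ℕ, (ArithmeticFunction.moebius d : ℝ) / (d : ℝ) ^ n = 1 := by
  have hs : 1 < ((n : ℂ)).re := by
    rw [Complex.natCast_re]; exact_mod_cast (by omega : 1 < n)
  have h := ArithmeticFunction.LSeries_zeta_mul_Lseries_moebius hs
  rw [ArithmeticFunction.LSeries_zeta_eq_riemannZeta hs,
    zeta_nat_eq_tsum_of_gt_one (by omega : 1 < n)] at h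
  have h2 : LSeries (fun d => (ArithmeticFunction.moebius d : ℂ)) n
      = ((∑' d : ℕ, (ArithmeticFunction.moebius d : ℝ) / (d : ℝ) ^ n : ℝ) : ℂ) := by
    rw [LSeries, Complex.ofReal_tsum]
    refine tsum_congr fun d => ?_
    rw [LSeries.term_def]
    split_ifs with hd
    · simp [hd]
    · push_cast
      rw [Complex.cpow_natCast]
  have h3 : (∑' d : ℕ, 1 / (d : ℂ) ^ n) = (zetaR n : ℂ) := by
    rw [zetaR_eq_tsum hn, Complex.ofReal_tsum]
    exact tsum_congr fun d => by push_cast; rfl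
  rw [h2, h3] at h
  exact_mod_cast h

lemma moebius_two_mul (d : ℕ) :
    ArithmeticFunction.moebius (2 * d) = if Even d then 0 else -ArithmeticFunction.moebius d := by
  split_ifs with hd
  · obtain ⟨c, rfl⟩ := hd
    refine ArithmeticFunction.moebius_eq_zero_of_not_squarefree fun h => ?_
    have := h 2 ⟨c, by ring⟩
    norm_num at this
  · rw [ArithmeticFunction.isMultiplicative_moebius.map_mul_of_coprime
      (Nat.coprime_two_left.2 (Nat.not_even_iff_odd.1 hd)),
      ArithmeticFunction.moebius_apply_prime Nat.prime_two, neg_one_mul]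

lemma tsum_moebius_mul (hn : 2 ≤ n) (a : ℝ) :
    ∑' d : ℕ, (ArithmeticFunction.moebius d : ℝ) * ((1 + if Even d then a else 0) / (d : ℝ) ^ n)
      = (1 - a / (2 ^ n - 1)) / zetaR n := by
  set m : ℕ → ℝ := fun d => (ArithmeticFunction.moebius d : ℝ) / (d : ℝ) ^ n with hm
  have hsum : Summable m := summable_moebius_div_pow hn
  have hE : Summable fun d => m (2 * d) :=
    hsum.comp_injective (fun a b h => by simpa using h)
  have hO : Summable fun d => m (2 * d + 1) :=
    hsum.comp_injective (fun a b h => by simpa using h)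
  have h1 := tsum_even_add_odd hE hO
  have hodd : ∀ d, m (2 * d) = -(1 / 2 ^ n) * if Even d then 0 else m d := by
    intro d
    simp only [hm, moebius_two_mul]
    split_ifs with hd
    · simp
    · push_cast
      rw [mul_pow]
      field_simp
  have h2 : ∑' d, m (2 * d) = -(1 / 2 ^ n) * ∑' d, m (2 * d + 1) := by
    rw [tsum_congr hodd, tsum_mul_left,
      ← tsum_even_add_odd (f := fun d => if Even d then 0 else m d)]
    · simp
    · simp
    · simpa [Nat.not_even_two_mul_add_one] using hO
  have hEven : Summable fun d => if Even d then m d else 0 :=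
    Summable.of_norm_bounded hsum.norm fun d => by split_ifs <;> simp
  have h3 : ∑' d, (if Even d then m d else 0) = ∑' d, m (2 * d) := by
    rw [← tsum_even_add_odd (f := fun d => if Even d then m d else 0)]
    · simp
    · simpa using hE
    · simp
  have h4 := zetaR_mul_tsum_moebius hn
  have hz : zetaR n ≠ 0 := left_ne_zero_of_mul_eq_one h4
  have hp : (4 : ℝ) ≤ 2 ^ n := by
    calc (4 : ℝ) = 2 ^ 2 := by norm_num
      _ ≤ 2 ^ n := pow_le_pow_right₀ (by norm_num) hn
  have hp1 : (2 : ℝ) ^ n - 1 ≠ 0 := by linarith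
  calc _ = ∑' d : ℕ, (m d + a * if Even d then m d else 0) := by
        refine tsum_congr fun d => ?_
        simp only [hm]
        split_ifs <;> ring
    _ = ∑' d, m d + a * ∑' d, m (2 * d) := by
        rw [hsum.tsum_add (hEven.mul_left a), tsum_mul_left, h3]
    _ = _ := by
        have h5 : ∑' d, m d = 1 / zetaR n := by rw [eq_div_iff hz, mul_comm]; exact h4
        have h6 : ∑' d, m (2 * d) = -(1 / zetaR n) / (2 ^ n - 1) := by
          rw [h5] at h1
          rw [eq_div_iff hp1]
          have : ∑' d, m (2 * d + 1) = -2 ^ n * ∑' d, m (2 * d) := by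
            rw [h2]; field_simp
          rw [this] at h1
          linarith
        rw [h5, h6]
        field_simp
        ring

/-! ### The density of elements with coprime exponent sums -/

/-- The greatest common divisor of the exponent sums of `f`. -/
def content (f : FreeGroup (Fin n)) : ℕ := univ.gcd fun i => (expo f i).natAbs

lemma dvd_content_iff {f : FreeGroup (Fin n)} {d : ℕ} :
    d ∣ content f ↔ ∀ i, (d : ℤ) ∣ expo f i := by
  simp [content, Finset.dvd_gcd_iff, Int.natCast_dvd]

lemma content_eq_zero_iff {f : FreeGroup (Fin n)} : content f = 0 ↔ ∀ i, expo f i = 0 := by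
  simp [content, Finset.gcd_eq_zero_iff]

open Classical in
/-- The proportion of points of the sphere of radius `s` that satisfy `p`. -/
noncomputable def density (n s : ℕ) (p : FreeGroup (Fin n) → Prop) : ℝ :=
  #{f ∈ sphere n s | p f} / #(sphere n s)

lemma density_eq (s : ℕ) (p : FreeGroup (Fin n) → Prop) [DecidablePred p] :
    density n s p = #{f ∈ sphere n s | p f} / #(sphere n s) := by
  unfold density
  congr!

lemma density_nonneg (s : ℕ) (p : FreeGroup (Fin n) → Prop) : 0 ≤ density n s p := by
  unfold density; positivity

lemma density_mono {s : ℕ} {p q : FreeGroup (Fin n) → Prop}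
    (h : ∀ f ∈ sphere n s, p f → q f) : density n s p ≤ density n s q := by
  classical
  unfold density
  gcongr with f hf
  exact h f hf

lemma density_or_le (s : ℕ) (p q : FreeGroup (Fin n) → Prop) :
    density n s (fun f => p f ∨ q f) ≤ density n s p + density n s q := by
  classical
  simp only [density_eq, filter_or]
  rw [← add_div]
  gcongr
  exact_mod_cast card_union_le _ _

lemma density_exists_le (s : ℕ) {ι : Type*} [Fintype ι] (p : ι → FreeGroup (Fin n) → Prop) :
    density n s (fun f => ∃ i, p i f) ≤ ∑ i, density n s (p i) := by
  classical
  simp only [density_eq]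
  rw [← sum_div]
  gcongr
  have : ({f ∈ sphere n s | ∃ i, p i f} : Finset _)
      = univ.biUnion fun i => {f ∈ sphere n s | p i f} := by
    ext f; simp
  rw [this]
  exact_mod_cast card_biUnion_le

lemma density_eq_divDensity (d s : ℕ) :
    density n s (fun f => d ∣ content f) = divDensity n d s := by
  classical
  unfold density divDensity divCount
  congr 3
  ext f
  simp [dvd_content_iff]

lemma tendsto_density_of_tendsto_and {α : Type*} {l : Filter α} {s : α → ℕ}
    {p : FreeGroup (Fin n) → Prop} {q : α → FreeGroup (Fin n) → Prop} {c : ℝ}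
    (hq : Tendsto (fun a => density n (s a) fun f => ¬ q a f) l (𝓝 0)) :
    Tendsto (fun a => density n (s a) fun f => p f ∧ q a f) l (𝓝 c) ↔
      Tendsto (fun a => density n (s a) p) l (𝓝 c) := by
  have h : Tendsto (fun a => density n (s a) p - density n (s a) fun f => p f ∧ q a f) l (𝓝 0) := by
    refine squeeze_zero (fun a => sub_nonneg.2 (density_mono fun f _ h => h.1)) (fun a => ?_) hq
    rw [sub_le_iff_le_add']
    refine le_trans (density_mono ?_) (density_or_le (s a) (fun f => p f ∧ q a f) _)
    intro f _ hf
    tauto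
  constructor
  · intro hlim
    simpa using h.add hlim
  · intro hlim
    simpa using hlim.sub h

/-- Exponent sums that do not all vanish and are bounded by `s ^ (2 / 3)`. -/
def Tame (s : ℕ) (f : FreeGroup (Fin n)) : Prop :=
  content f ≠ 0 ∧ ∀ i, |expo f i| ^ 3 ≤ (s : ℤ) ^ 2

lemma Tame.cube_le {s d : ℕ} {f : FreeGroup (Fin n)} (hf : Tame s f) (hd : d ∣ content f) :
    d ^ 3 ≤ s ^ 2 := by
  have h : ∃ i, expo f i ≠ 0 := by
    by_contra! h
    exact hf.1 (content_eq_zero_iff.2 h)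
  obtain ⟨i, hi⟩ := h
  have h1 : (d : ℤ) ≤ |expo f i| :=
    Int.le_of_dvd (abs_pos.2 hi) ((dvd_abs _ _).2 (dvd_content_iff.1 hd i))
  have h2 : (d : ℤ) ^ 3 ≤ (s : ℤ) ^ 2 := le_trans (by gcongr) (hf.2 i)
  exact_mod_cast h2

lemma le_of_cube_le_sq {d s : ℕ} (h : d ^ 3 ≤ s ^ 2) : d ≤ s := by
  by_contra! hlt
  have h1 : s ^ 2 < d ^ 2 := Nat.pow_lt_pow_left hlt (by norm_num)
  have h2 : d ^ 2 ≤ d ^ 3 := Nat.pow_le_pow_right (by omega) (by norm_num)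
  omega

lemma tendsto_density_not_tame (hn : 2 ≤ n) :
    Tendsto (fun s : ℕ => density n s fun f => ¬ Tame s f) atTop (𝓝 0) := by
  classical
  obtain ⟨C, hC, h⟩ := exists_divDensity_le hn
  have hlim : Tendsto (fun s : ℕ => C * ((1 : ℝ) / s + 1 / √(s : ℝ)) ^ n + n * (69120 / (s : ℝ)))
      atTop (𝓝 0) := by
    have h1 : Tendsto (fun s : ℕ => (1 : ℝ) / s) atTop (𝓝 0) := tendsto_one_div_atTop_nhds_zero_nat
    have h2 : Tendsto (fun s : ℕ => (1 : ℝ) / √(s : ℝ)) atTop (𝓝 0) :=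
      (Real.tendsto_sqrt_atTop.comp tendsto_natCast_atTop_atTop).const_div_atTop 1
    have h3 : Tendsto (fun s : ℕ => (69120 : ℝ) / s) atTop (𝓝 0) :=
      tendsto_natCast_atTop_atTop.const_div_atTop _
    have h4 := (((h1.add h2).pow n).const_mul C).add (h3.const_mul (n : ℝ))
    simpa [show n ≠ 0 by omega] using h4
  refine squeeze_zero' (Eventually.of_forall fun s => density_nonneg s _) ?_ hlim
  filter_upwards [eventually_gt_atTop 0] with s hs
  have hbad : density n s (fun f => ¬ Tame s f)
      ≤ density n s (fun f => s ∣ content f ∨ ∃ i, (s : ℤ) ^ 2 < |expo f i| ^ 3) := by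
    refine density_mono fun f _ hf => ?_
    by_contra! hcon
    exact hf ⟨fun h0 => hcon.1 (by simp [h0]), hcon.2⟩
  refine hbad.trans ((density_or_le _ _ _).trans (add_le_add ?_ ?_))
  · rw [density_eq_divDensity]
    exact h s s hs hs
  · refine (density_exists_le _ _).trans ?_
    refine (sum_le_card_nsmul univ _ (69120 / (s : ℝ)) fun i _ => ?_).trans ?_
    · have h5 := card_large_expo_mul_le hn i s
      have hpos : (0 : ℝ) < #(sphere n s) := by exact_mod_cast card_sphere_pos (by omega) s
      have hs' : (0 : ℝ) < s := by exact_mod_cast hs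
      rwa [density_eq, div_le_div_iff₀ hpos hs']
    · simp

lemma sum_moebius_divisors (m : ℕ) :
    ∑ d ∈ m.divisors, ArithmeticFunction.moebius d = if m = 1 then 1 else 0 := by
  rw [← ArithmeticFunction.coe_mul_zeta_apply, ArithmeticFunction.moebius_mul_coe_zeta,
    ArithmeticFunction.one_apply]

lemma density_coprime_and_tame (s : ℕ) :
    density n s (fun f => content f = 1 ∧ Tame s f) =
      ∑' d : ℕ, (ArithmeticFunction.moebius d : ℝ) *
        density n s (fun f => d ∣ content f ∧ Tame s f) := by
  classical
  have hzero : ∀ d ∉ range (s + 1), (ArithmeticFunction.moebius d : ℝ) *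
      density n s (fun f => d ∣ content f ∧ Tame s f) = 0 := by
    intro d hd
    have : ({f ∈ sphere n s | d ∣ content f ∧ Tame s f} : Finset _) = ∅ := by
      refine filter_eq_empty_iff.2 fun f _ hf => hd ?_
      exact mem_range.2 (Nat.lt_succ_of_le (le_of_cube_le_sq (hf.2.cube_le hf.1)))
    simp [density, this]
  rw [tsum_eq_sum hzero]
  unfold density
  simp only [← mul_div_assoc, ← sum_div]
  congr 1
  simp only [card_filter, Nat.cast_sum, mul_sum]
  rw [sum_comm]
  refine sum_congr rfl fun f _ => ?_
  by_cases hf : Tame s f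
  · have hdiv : (content f).divisors = {d ∈ range (s + 1) | d ∣ content f} := by
      ext d
      simp only [Nat.mem_divisors, mem_filter, mem_range]
      exact ⟨fun h => ⟨Nat.lt_succ_of_le (le_of_cube_le_sq (hf.cube_le h.1)), h.1⟩,
        fun h => ⟨h.2, hf.1⟩⟩
    have h := sum_moebius_divisors (content f)
    rw [hdiv, sum_filter] at h
    have h' := congrArg (Int.cast : ℤ → ℝ) h
    push_cast at h'
    simp only [hf, and_true, Nat.cast_ite, Nat.cast_one, Nat.cast_zero, mul_ite, mul_one,
      mul_zero]
    exact h'.symm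
  · simp [hf]

lemma density_dvd_and_tame_le (hn : 2 ≤ n) : ∃ C : ℝ, ∀ d s : ℕ, 0 < d →
    density n s (fun f => d ∣ content f ∧ Tame s f) ≤ C * (1 / (d : ℝ) ^ (3 / 2 : ℝ)) := by
  classical
  obtain ⟨C, hC, h⟩ := exists_divDensity_le hn
  refine ⟨C * 2 ^ n, fun d s hd => ?_⟩
  have hd' : (1 : ℝ) ≤ d := by exact_mod_cast hd
  by_cases hds : d ^ 3 ≤ s ^ 2
  · have hs : 0 < s := lt_of_lt_of_le hd (le_of_cube_le_sq hds)
    have hs' : (0 : ℝ) < s := by exact_mod_cast hs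
    have h1 : density n s (fun f => d ∣ content f ∧ Tame s f) ≤ divDensity n d s := by
      rw [← density_eq_divDensity]
      exact density_mono fun f _ hf => hf.1
    refine (h1.trans (h d s hd hs)).trans ?_
    rw [mul_assoc]
    refine mul_le_mul_of_nonneg_left ?_ hC
    set r : ℝ := (d : ℝ) ^ (-(3 / 4) : ℝ) with hr
    have hr0 : 0 < r := by positivity
    have hr1 : r ≤ 1 := Real.rpow_le_one_of_one_le_of_nonpos hd' (by norm_num)
    have e1 : (1 : ℝ) / d ≤ r := by
      rw [one_div, ← Real.rpow_neg_one, hr]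
      exact Real.rpow_le_rpow_of_exponent_le hd' (by norm_num)
    have e2 : 1 / √(s : ℝ) ≤ r := by
      have e3 : (d : ℝ) ^ (3 / 4 : ℝ) ≤ √(s : ℝ) := by
        refine le_of_pow_le_pow_left₀ (n := 4) (by norm_num) (by positivity) ?_
        rw [← Real.rpow_natCast, ← Real.rpow_mul (by positivity)]
        have : √(s : ℝ) ^ 4 = (s : ℝ) ^ 2 := by
          rw [show (4 : ℕ) = 2 * 2 by norm_num, pow_mul, Real.sq_sqrt hs'.le]
        rw [this]
        norm_num
        exact_mod_cast hds
      rw [hr, Real.rpow_neg (by positivity), one_div]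
      gcongr
    have e4 : (1 : ℝ) / (d : ℝ) ^ (3 / 2 : ℝ) = r ^ 2 := by
      rw [hr, ← Real.rpow_natCast, ← Real.rpow_mul (by positivity), one_div,
        ← Real.rpow_neg (by positivity)]
      norm_num
    rw [e4]
    calc ((1 : ℝ) / d + 1 / √(s : ℝ)) ^ n ≤ (2 * r) ^ n := by
          gcongr
          linarith
      _ = 2 ^ n * r ^ n := mul_pow _ _ _
      _ ≤ 2 ^ n * r ^ 2 := by
          gcongr ?_ * ?_
          exact pow_le_pow_of_le_one hr0.le hr1 hn
  · have : ({f ∈ sphere n s | d ∣ content f ∧ Tame s f} : Finset _) = ∅ :=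
      filter_eq_empty_iff.2 fun f _ hf => hds (hf.2.cube_le hf.1)
    simp only [density, this, card_empty, Nat.cast_zero, zero_div]
    positivity

/-- The density of the elements with coprime exponent sums, along radii of fixed parity. -/
lemma tendsto_density_coprime (hn : 2 ≤ n) {ε : ℕ} (hε : ε ≤ 1) :
    Tendsto (fun m : ℕ => density n (2 * m + ε) fun f => content f = 1) atTop
      (𝓝 (((2 ^ n : ℝ) - 2 * (1 - (ε : ℝ))) / ((2 ^ n - 1) * zetaR n))) := by
  have hradius : Tendsto (fun m : ℕ => 2 * m + ε) atTop atTop :=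
    tendsto_atTop_mono (fun m => by omega : ∀ m : ℕ, m ≤ 2 * m + ε) tendsto_id
  have htame := (tendsto_density_not_tame hn).comp hradius
  rw [← tendsto_density_of_tendsto_and (q := fun m => Tame (2 * m + ε)) htame]
  obtain ⟨C, hC⟩ := density_dvd_and_tame_le hn
  simp only [density_coprime_and_tame]
  have hval : ((2 ^ n : ℝ) - 2 * (1 - (ε : ℝ))) / ((2 ^ n - 1) * zetaR n)
      = ∑' d : ℕ, (ArithmeticFunction.moebius d : ℝ) *
        ((1 + if Even d then (-1) ^ ε else 0) / (d : ℝ) ^ n) := by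
    rw [tsum_moebius_mul hn]
    have hp : (4 : ℝ) ≤ 2 ^ n := by
      calc (4 : ℝ) = 2 ^ 2 := by norm_num
        _ ≤ 2 ^ n := pow_le_pow_right₀ (by norm_num) hn
    have hp1 : (2 : ℝ) ^ n - 1 ≠ 0 := by linarith
    have hz : zetaR n ≠ 0 := left_ne_zero_of_mul_eq_one (zetaR_mul_tsum_moebius hn)
    interval_cases ε <;> field_simp <;> norm_num <;> ring
  rw [hval]
  refine tendsto_tsum_of_dominated_convergence
    (bound := fun d : ℕ => C * (1 / (d : ℝ) ^ (3 / 2 : ℝ)))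
    ((Real.summable_one_div_nat_rpow.2 (by norm_num)).mul_left C) (fun d => ?_)
    (Eventually.of_forall fun m d => ?_)
  · rcases Nat.eq_zero_or_pos d with rfl | hd
    · simp
    refine Tendsto.const_mul _ ?_
    rw [tendsto_density_of_tendsto_and (q := fun m => Tame (2 * m + ε)) htame]
    simp only [density_eq_divDensity]
    exact tendsto_divDensity hn hd ε
  · rcases Nat.eq_zero_or_pos d with rfl | hd
    · simp
    rw [norm_mul, Real.norm_of_nonneg (density_nonneg _ _)]
    have : ‖(ArithmeticFunction.moebius d : ℝ)‖ ≤ 1 := by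
      rw [Real.norm_eq_abs]
      exact_mod_cast ArithmeticFunction.abs_moebius_le_one (n := d)
    exact (mul_le_of_le_one_left (density_nonneg _ _) this).trans (hC d _ hd)

/-! ### Homomorphisms between free groups -/

lemma exists_hom_apply_eq {G : Type*} [Group G] {f : FreeGroup (Fin n)} (hf : content f = 1)
    (g : G) : ∃ φ : FreeGroup (Fin n) →* G, φ f = g := by
  obtain ⟨a, ha⟩ := Finset.gcd_eq_sum_mul univ (expo f)
  have hu : IsUnit (univ.gcd (expo f)) := by
    rw [Int.isUnit_iff_natAbs_eq, ← Nat.dvd_one, ← hf, dvd_content_iff]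
    exact fun i => Int.natAbs_dvd.2 (gcd_dvd (mem_univ i))
  obtain ⟨u, hu⟩ := hu
  refine ⟨(zpowersHom G g).comp
    (FreeGroup.lift fun i => Multiplicative.ofAdd (a i * ((u⁻¹ : ℤˣ) : ℤ))), ?_⟩
  have h : FreeGroup.lift (fun i => Multiplicative.ofAdd (a i * ((u⁻¹ : ℤˣ) : ℤ))) f
      = Multiplicative.ofAdd 1 := by
    rw [lift_eq_prod_zpow]
    simp only [← ofAdd_zsmul, ← ofAdd_sum, smul_eq_mul, ← mul_assoc]
    rw [← sum_mul, ← ha, ← hu, Units.mul_inv]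
  rw [MonoidHom.comp_apply, h]
  simp

lemma expo_map {k : ℕ} (φ : FreeGroup (Fin n) →* FreeGroup (Fin k)) (f : FreeGroup (Fin n))
    (j : Fin k) : expo (φ f) j = ∑ i, expo f i * expo (φ (FreeGroup.of i)) j := by
  induction f using FreeGroup.induction_on with
  | C1 => simp
  | of i => simp [Pi.single_apply]
  | inv_of i h => simp [h]
  | mul x y hx hy => simp [hx, hy, add_mul, sum_add_distrib]

lemma content_dvd_content_map {k : ℕ} (φ : FreeGroup (Fin n) →* FreeGroup (Fin k))
    (f : FreeGroup (Fin n)) : content f ∣ content (φ f) := by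
  rw [dvd_content_iff]
  intro j
  rw [expo_map]
  exact dvd_sum fun i _ => Dvd.dvd.mul_right (dvd_content_iff.1 dvd_rfl i) _

lemma ncard_sphere (n s : ℕ) :
    {f : FreeGroup (Fin n) | f.toWord.length = s}.ncard = #(sphere n s) := by
  rw [← Set.ncard_coe_finset]
  congr 1
  ext f
  simp

lemma eGammaFree_eq (n k s t : ℕ) [DecidablePred fun p : FreeGroup (Fin n) × FreeGroup (Fin k) =>
      ∃ φ : FreeGroup (Fin n) →* FreeGroup (Fin k), φ p.1 = p.2] :
    eGammaFree n k s t = #{p ∈ sphere n s ×ˢ sphere k t |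
      ∃ φ : FreeGroup (Fin n) →* FreeGroup (Fin k), φ p.1 = p.2} /
        ((#(sphere n s) : ℝ) * #(sphere k t)) := by
  unfold eGammaFree
  congr 2
  · rw [← Set.ncard_coe_finset]
    congr 2
    ext p
    simp [and_assoc]
  all_goals rw [ncard_sphere]

lemma density_le_eGammaFree {k : ℕ} (hk : 1 ≤ k) (s t : ℕ) :
    density n s (fun f => content f = 1) ≤ eGammaFree n k s t := by
  classical
  have hM : (0 : ℝ) < #(sphere k t) := by exact_mod_cast card_sphere_pos hk t
  rw [eGammaFree_eq, density_eq, ← mul_div_mul_right _ _ hM.ne']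
  gcongr
  rw [← Nat.cast_mul, ← card_product, Nat.cast_le]
  refine card_le_card fun p hp => ?_
  simp only [mem_product, mem_filter] at hp ⊢
  exact ⟨⟨hp.1.1, hp.2⟩, exists_hom_apply_eq hp.1.2 _⟩

lemma eGammaFree_le {k : ℕ} (hn : 1 ≤ n) (hk : 1 ≤ k) (s t : ℕ) :
    eGammaFree n k s t ≤ 1 - density k t (fun g => content g = 1) *
      (1 - density n s fun f => content f = 1) := by
  classical
  have hN : (0 : ℝ) < #(sphere n s) := by exact_mod_cast card_sphere_pos hn s
  have hM : (0 : ℝ) < #(sphere k t) := by exact_mod_cast card_sphere_pos hk t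
  have hdisj : Disjoint
      ({p ∈ sphere n s ×ˢ sphere k t |
        ∃ φ : FreeGroup (Fin n) →* FreeGroup (Fin k), φ p.1 = p.2} : Finset _)
      ({f ∈ sphere n s | ¬ content f = 1} ×ˢ {g ∈ sphere k t | content g = 1}) := by
    rw [disjoint_left]
    rintro ⟨f, g⟩ h1 h2
    simp only [mem_product, mem_filter] at h1 h2
    obtain ⟨-, φ, rfl⟩ := h1
    exact h2.1.2 (Nat.dvd_one.1 (h2.2.2 ▸ content_dvd_content_map φ f))
  have hcard := card_le_card (union_subset (filter_subset _ _)
    (product_subset_product (filter_subset _ _) (filter_subset _ _)) :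
      ({p ∈ sphere n s ×ˢ sphere k t |
        ∃ φ : FreeGroup (Fin n) →* FreeGroup (Fin k), φ p.1 = p.2} : Finset _) ∪
      ({f ∈ sphere n s | ¬ content f = 1} ×ˢ {g ∈ sphere k t | content g = 1})
        ⊆ sphere n s ×ˢ sphere k t)
  rw [card_union_of_disjoint hdisj, card_product, card_product] at hcard
  have hsplit := card_filter_add_card_filter_not (s := sphere n s) fun f => content f = 1
  have hcard' := (Nat.cast_le (α := ℝ)).2 hcard
  have hsplit' := congrArg (Nat.cast : ℕ → ℝ) hsplit
  push_cast at hcard' hsplit'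
  rw [eGammaFree_eq, density_eq, density_eq, div_le_iff₀ (by positivity)]
  refine (le_sub_iff_add_le.2 hcard').trans_eq ?_
  rw [← eq_sub_iff_add_eq'] at hsplit'
  rw [hsplit']
  field_simp

end FreeGroupSphere

/-- Let `n, k ≥ 2` and `ε, δ ∈ {0,1}`. Then
`(2^n − 2(1−ε))/((2^n − 1)ζ(n)) ≤ liminf_{(s,t)→∞} e_γ(F_n, F_k, 2s+ε, 2t+δ)` and
`limsup_{(s,t)→∞} e_γ(F_n, F_k, 2s+ε, 2t+δ)
  ≤ 1 − ((2^k − 2(1−δ))/((2^k − 1)ζ(k)))(1 − (2^n − 2(1−ε))/((2^n − 1)ζ(n)))`. -/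
theorem stmt_17 (n k : ℕ) (hn : 2 ≤ n) (hk : 2 ≤ k)
    (ε δ : ℕ) (hε : ε ≤ 1) (hδ : δ ≤ 1) :
    ((2 ^ n : ℝ) - 2 * (1 - (ε : ℝ))) / ((2 ^ n - 1) * zetaR n) ≤
      liminf (fun st : ℕ × ℕ => eGammaFree n k (2 * st.1 + ε) (2 * st.2 + δ))
        (atTop ×ˢ atTop) ∧
    limsup (fun st : ℕ × ℕ => eGammaFree n k (2 * st.1 + ε) (2 * st.2 + δ))
        (atTop ×ˢ atTop) ≤
      1 - ((2 ^ k : ℝ) - 2 * (1 - (δ : ℝ))) / ((2 ^ k - 1) * zetaR k) *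
        (1 - ((2 ^ n : ℝ) - 2 * (1 - (ε : ℝ))) / ((2 ^ n - 1) * zetaR n)) := by
  have hf := (FreeGroupSphere.tendsto_density_coprime hn hε).comp
    (tendsto_fst (f := (atTop : Filter ℕ)) (g := (atTop : Filter ℕ)))
  have hg := (FreeGroupSphere.tendsto_density_coprime hk hδ).comp
    (tendsto_snd (f := (atTop : Filter ℕ)) (g := (atTop : Filter ℕ)))
  have hlower : ∀ st : ℕ × ℕ, FreeGroupSphere.density n (2 * st.1 + ε)
      (fun f => FreeGroupSphere.content f = 1) ≤ eGammaFree n k (2 * st.1 + ε) (2 * st.2 + δ) :=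
    fun st => FreeGroupSphere.density_le_eGammaFree (by omega) _ _
  have hupper : ∀ st : ℕ × ℕ, eGammaFree n k (2 * st.1 + ε) (2 * st.2 + δ) ≤
      1 - FreeGroupSphere.density k (2 * st.2 + δ) (fun g => FreeGroupSphere.content g = 1) *
        (1 - FreeGroupSphere.density n (2 * st.1 + ε)
          fun f => FreeGroupSphere.content f = 1) :=
    fun st => FreeGroupSphere.eGammaFree_le (by omega) (by omega) _ _
  have hu := (hg.mul (hf.const_sub 1)).const_sub 1
  have hbelow : IsBoundedUnder (· ≥ ·) (atTop ×ˢ atTop)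
      (fun st : ℕ × ℕ => eGammaFree n k (2 * st.1 + ε) (2 * st.2 + δ)) :=
    hf.isBoundedUnder_ge.mono_ge (Eventually.of_forall hlower)
  have habove : IsBoundedUnder (· ≤ ·) (atTop ×ˢ atTop)
      (fun st : ℕ × ℕ => eGammaFree n k (2 * st.1 + ε) (2 * st.2 + δ)) :=
    hu.isBoundedUnder_le.mono_le (Eventually.of_forall hupper)
  constructor
  · rw [← hf.liminf_eq]
    exact liminf_le_liminf (Eventually.of_forall hlower) hf.isBoundedUnder_ge
      habove.isCoboundedUnder_ge
  · rw [← hu.limsup_eq]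
    exact limsup_le_limsup (Eventually.of_forall hupper) hbelow.isCoboundedUnder_le
      hu.isBoundedUnder_le
end

section
/- Let n, k ≥ 2, let F_n be the free group of rank n on basis x_1,…,x_n, and let G be the free group of rank k, with reduced-word lengths |·|. For natural numbers s, t, let A(s,t) = #{(z,w) ∈ F_n×G : |z| = s, |w| = t, and there exists a group homomorphism φ : F_n → G with φ(z) = w} / (#{z ∈ F_n : |z| = s} · #{w ∈ G : |w| = t}) be the proportion of solvable (s,t)-homogeneous equations in G in n variables. Then 0 < liminf_{(s,t)→(∞,∞)} A(s,t) ≤ limsup_{(s,t)→(∞,∞)} A(s,t) < 1. -/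
open Filter

/-- The proportion `A(s,t)` of solvable `(s,t)`-homogeneous equations in the free group
`G = F_k` of rank `k`, in `n` variables: identifying the left-hand side of an equation
with an element `z` of the free group `F_n` of reduced-word length `s` and the right-hand
side with `w ∈ G` of reduced-word length `t`, this is the proportion, among all such pairs
`(z,w)`, of those for which there is a homomorphism `φ : F_n → G` with `φ(z) = w`. -/
noncomputable def solvRatio (n k : ℕ) (s t : ℕ) : ℝ :=
  ({zw : FreeGroup (Fin n) × FreeGroup (Fin k) |
      zw.1.toWord.length = s ∧ zw.2.toWord.length = t ∧
      ∃ φ : FreeGroup (Fin n) →* FreeGroup (Fin k), φ zw.1 = zw.2}.ncard : ℝ) /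
    (({z : FreeGroup (Fin n) | z.toWord.length = s}.ncard : ℝ) *
      ({w : FreeGroup (Fin k) | w.toWord.length = t}.ncard : ℝ))

theorem sum_truncSub_le {f : ℕ → ℕ} {h : ℕ} (hup : ∀ i < h, f i ≤ f (i + 1))
    (hdown : ∀ i, h ≤ i → f (i + 1) ≤ f i) (n : ℕ) :
    ∑ i ∈ Finset.range n, (f i - f (i + 1)) ≤ f h := by
  have key : (n ≤ h → ∑ i ∈ Finset.range n, (f i - f (i + 1)) = 0) ∧
      (h ≤ n → ∑ i ∈ Finset.range n, (f i - f (i + 1)) + f n = f h) := by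
    induction n with
    | zero =>
      refine ⟨fun _ => by simp, fun hn => ?_⟩
      obtain rfl : h = 0 := by omega
      simp
    | succ n ih =>
      rw [Finset.sum_range_succ]
      refine ⟨fun hn => ?_, fun hn => ?_⟩
      · have := hup n (by omega)
        have := ih.1 (by omega)
        omega
      · rcases Nat.lt_or_ge n h with hlt | hge
        · obtain rfl : h = n + 1 := by omega
          have := hup n (by omega)
          have := ih.1 (by omega)
          omega
        · have := hdown n hge
          have := ih.2 hge
          omega
  rcases le_total n h with hn | hn
  · rw [key.1 hn]; exact Nat.zero_le _
  · have := key.2 hn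
    omega

theorem le_add_sum_truncSub (f : ℕ → ℕ) (j r : ℕ) :
    f j ≤ f (j + r) + ∑ i ∈ Finset.range r, (f (j + i) - f (j + i + 1)) := by
  induction r with
  | zero => simp
  | succ r ih =>
    rw [Finset.sum_range_succ, ← add_assoc j r 1]
    omega

/-- A unimodal sequence has at most `1 / p` of its mass, up to an error `max f`, on a set of
integers that are pairwise at least `p` apart. -/
theorem mul_sum_spaced_le {f : ℕ → ℕ} {h p N : ℕ} (hup : ∀ i < h, f i ≤ f (i + 1))
    (hdown : ∀ i, h ≤ i → f (i + 1) ≤ f i) (S : Finset ℕ) (hS : S ⊆ Finset.range N)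
    (hsp : ∀ i ∈ S, ∀ j ∈ S, i < j → i + p ≤ j) :
    p * ∑ j ∈ S, f j ≤ ∑ i ∈ Finset.range (N + p), f i + p * f h := by
  set g : ℕ → ℕ := fun i => f i + p * (f i - f (i + 1)) with hg
  have h1 : p * ∑ j ∈ S, f j ≤ ∑ j ∈ S, ∑ r ∈ Finset.range p, g (j + r) := by
    rw [Finset.mul_sum]
    refine Finset.sum_le_sum fun j _ => ?_
    rw [hg]
    simp only [Finset.sum_add_distrib, ← Finset.mul_sum]
    have : ∀ r ∈ Finset.range p, f j ≤ f (j + r) +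
        ∑ i ∈ Finset.range p, (f (j + i) - f (j + i + 1)) := fun r hr => by
      refine (le_add_sum_truncSub f j r).trans ?_
      gcongr
      exact (Finset.mem_range.1 hr).le
    have := Finset.sum_le_sum this
    simpa [Finset.sum_add_distrib] using this
  have h2 : ∑ j ∈ S, ∑ r ∈ Finset.range p, g (j + r) ≤ ∑ i ∈ Finset.range (N + p), g i := by
    rw [← Finset.sum_product']
    have hinj : Set.InjOn (fun x : ℕ × ℕ => x.1 + x.2) (S ×ˢ Finset.range p : Finset (ℕ × ℕ)) := by
      rintro ⟨a, b⟩ hab ⟨c, d⟩ hcd hac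
      simp only [Finset.coe_product, Set.mem_prod, Finset.mem_coe, Finset.mem_range] at hab hcd hac
      have := hsp a hab.1 c hcd.1
      have := hsp c hcd.1 a hab.1
      ext <;> simp <;> omega
    rw [← Finset.sum_image (f := g) hinj]
    refine Finset.sum_le_sum_of_subset fun i hi => ?_
    obtain ⟨⟨a, b⟩, hab, rfl⟩ := Finset.mem_image.1 hi
    simp only [Finset.mem_product, Finset.mem_range] at hab ⊢
    have := Finset.mem_range.1 (hS hab.1)
    omega
  refine h1.trans (h2.trans ?_)
  rw [hg, Finset.sum_add_distrib, ← Finset.mul_sum]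
  gcongr
  exact sum_truncSub_le hup hdown _

theorem mul_sum_choose_spaced_le {p m : ℕ} (S : Finset ℕ) (hS : S ⊆ Finset.range (m + 1))
    (hsp : ∀ i ∈ S, ∀ j ∈ S, i < j → i + p ≤ j) :
    p * ∑ j ∈ S, m.choose j ≤ 2 ^ m + p * m.choose (m / 2) := by
  have hdown : ∀ i, m / 2 ≤ i → m.choose (i + 1) ≤ m.choose i := fun i hi => by
    rcases Nat.lt_or_ge i m with him | him
    · have := Nat.choose_le_succ_of_lt_half_left (r := m - (i + 1)) (n := m) 
      rcases Nat.lt_or_ge (m - (i + 1)) (m / 2) with hlt | hge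
      · have := this hlt
        rwa [show m - (i + 1) + 1 = m - i by omega, Nat.choose_symm (by omega),
          Nat.choose_symm (by omega)] at this
      · rw [Nat.choose_symm_of_eq_add (show m = (i + 1) + i by omega)]
    · rw [Nat.choose_eq_zero_of_lt (by omega)]; exact Nat.zero_le _
  refine (mul_sum_spaced_le (f := m.choose) (fun i hi => Nat.choose_le_succ_of_lt_half_left hi) hdown S hS
    hsp).trans_eq ?_
  congr 1
  rw [← Nat.sum_range_choose]
  symm
  refine Finset.sum_subset (fun i => by simp; omega) fun i _ hi => ?_
  exact Nat.choose_eq_zero_of_lt (by simpa using hi)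

theorem centralBinom_sq_mul_le (n : ℕ) : n.centralBinom ^ 2 * (2 * n + 1) ≤ 16 ^ n := by
  induction n with
  | zero => simp
  | succ n ih =>
    have h := Nat.succ_mul_centralBinom_succ n
    have h2 : (n + 1) ^ 2 * ((n + 1).centralBinom ^ 2 * (2 * (n + 1) + 1)) ≤
        (n + 1) ^ 2 * 16 ^ (n + 1) := by
      calc (n + 1) ^ 2 * ((n + 1).centralBinom ^ 2 * (2 * (n + 1) + 1))
          = ((n + 1) * (n + 1).centralBinom) ^ 2 * (2 * n + 3) := by ring
        _ = (n.centralBinom ^ 2 * (2 * n + 1)) * (4 * ((2 * n + 1) * (2 * n + 3))) := by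
          rw [h]; ring
        _ ≤ 16 ^ n * (4 * (4 * (n + 1) ^ 2)) :=
          Nat.mul_le_mul ih (by nlinarith)
        _ = _ := by ring
    exact Nat.le_of_mul_le_mul_left h2 (by positivity)

theorem choose_half_sq_mul_le (m : ℕ) : m.choose (m / 2) ^ 2 * m ≤ 4 ^ m := by
  rcases Nat.even_or_odd' m with ⟨h, rfl | rfl⟩
  · have := centralBinom_sq_mul_le h
    rw [Nat.centralBinom_eq_two_mul_choose] at this
    rw [show 2 * h / 2 = h by omega, pow_mul]
    norm_num
    nlinarith
  · have := centralBinom_sq_mul_le (h + 1)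
    rw [Nat.centralBinom_eq_two_mul_choose, show 2 * (h + 1) = 2 * h + 1 + 1 by ring,
      Nat.choose_succ_succ, Nat.choose_symm_half] at this
    rw [show (2 * h + 1) / 2 = h by omega, pow_succ 4, pow_mul]
    norm_num
    rw [pow_succ 16] at this
    nlinarith

theorem choose_half_div_le {c m : ℕ} (hc : 0 < c) (hcm : c ≤ m) :
    (m.choose (m / 2) : ℝ) / 2 ^ m ≤ 1 / √c := by
  rw [div_le_div_iff₀ (by positivity) (by positivity), one_mul]
  refine abs_le_of_sq_le_sq' ?_ (by positivity) |>.2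
  rw [mul_pow, Real.sq_sqrt (by positivity), ← pow_mul, mul_comm m 2, pow_mul]
  have h := choose_half_sq_mul_le m
  have h' : (m.choose (m / 2) : ℝ) ^ 2 * m ≤ 4 ^ m := by exact_mod_cast h
  have : (c : ℝ) ≤ m := by exact_mod_cast hcm
  norm_num
  refine le_trans ?_ h'
  gcongr

theorem card_powerset_dvd_le {ι : Type*} (J : Finset ι) {p : ℕ} (hp : Odd p) (c : ℤ) :
    p * (J.powerset.filter fun U => (p : ℤ) ∣ c - 2 * U.card).card ≤
      2 ^ J.card + p * J.card.choose (J.card / 2) := by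
  classical
  set S := (Finset.range (J.card + 1)).filter fun j : ℕ => (p : ℤ) ∣ c - 2 * j with hS
  have hcop : IsCoprime (p : ℤ) 2 := by
    exact_mod_cast Nat.isCoprime_iff_coprime.2 (Nat.coprime_two_right.2 hp)
  have hcard : (J.powerset.filter fun U => (p : ℤ) ∣ c - 2 * U.card).card ≤
      ∑ j ∈ S, J.card.choose j := by
    rw [Finset.card_eq_sum_card_fiberwise (f := Finset.card) (t := S)]
    · refine Finset.sum_le_sum fun j _ => ?_
      rw [← Finset.card_powersetCard]
      refine Finset.card_le_card fun U hU => ?_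
      simp only [Finset.mem_filter, Finset.mem_powerset] at hU
      exact Finset.mem_powersetCard.2 ⟨hU.1.1, hU.2⟩
    · intro U hU
      simp only [Finset.coe_filter, Finset.mem_powerset, Set.mem_ofPred_eq, hS,
        Finset.mem_range] at hU ⊢
      exact ⟨Nat.lt_succ_of_le (Finset.card_le_card hU.1), hU.2⟩
  refine (Nat.mul_le_mul_left p hcard).trans
    (mul_sum_choose_spaced_le S (Finset.filter_subset _ _) fun i hi j hj hij => ?_)
  have hd : (p : ℤ) ∣ 2 * ((j : ℤ) - i) := by
    have := dvd_sub (Finset.mem_filter.1 hi).2 (Finset.mem_filter.1 hj).2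
    rwa [show c - 2 * (i : ℤ) - (c - 2 * j) = 2 * (j - i) by ring] at this
  have := Int.le_of_dvd (by omega) (hcop.dvd_of_dvd_mul_left hd)
  omega

theorem card_signs_dvd_le {ι : Type*} [Fintype ι] [DecidableEq ι] (J : Finset ι) {p : ℕ}
    (hp : Odd p) (c : ℤ) (ε : ι → ℤ) (hε : ∀ i, ε i = 1 ∨ ε i = -1) :
    p * (Finset.univ.filter fun T : Finset ι =>
      (p : ℤ) ∣ c - 2 * ∑ i ∈ T ∩ J, ε i).card ≤
      (2 ^ J.card + p * J.card.choose (J.card / 2)) * 2 ^ (Fintype.card ι - J.card) := by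
  set Jn := J.filter fun i => ε i = -1 with hJn
  have hsum : ∀ T : Finset ι, ∑ i ∈ T ∩ J, ε i = ((symmDiff T Jn ∩ J).card : ℤ) - Jn.card := by
    intro T
    rw [Finset.card_eq_sum_ones, Finset.card_eq_sum_ones, Finset.inter_comm T,
      Finset.inter_comm _ J, ← Finset.filter_mem_eq_inter, ← Finset.filter_mem_eq_inter, hJn]
    push_cast
    rw [Finset.sum_filter, Finset.sum_filter, Finset.sum_filter, ← Finset.sum_sub_distrib]
    refine Finset.sum_congr rfl fun i hi => ?_
    rcases hε i with h | h <;> by_cases hT : i ∈ T <;>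
      simp [Finset.mem_symmDiff, hi, h, hT]
  have hle : (Finset.univ.filter fun T : Finset ι =>
      (p : ℤ) ∣ c - 2 * ∑ i ∈ T ∩ J, ε i).card ≤
      ((J.powerset.filter fun U => (p : ℤ) ∣ (c + 2 * Jn.card) - 2 * U.card) ×ˢ
        Jᶜ.powerset).card := by
    refine Finset.card_le_card_of_injOn
      (fun T => (symmDiff T Jn ∩ J, symmDiff T Jn ∩ Jᶜ)) ?_ ?_
    · intro T hT
      simp only [Finset.coe_filter, Finset.mem_univ, true_and, Set.mem_ofPred_eq, hsum] at hT
      simp only [Finset.coe_product, Set.mem_prod, Finset.mem_coe, Finset.mem_filter,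
        Finset.mem_powerset, Finset.inter_subset_right, true_and, and_true]
      rwa [show c + 2 * (Jn.card : ℤ) - 2 * ((symmDiff T Jn ∩ J).card : ℤ) =
        c - 2 * (((symmDiff T Jn ∩ J).card : ℤ) - Jn.card) by ring]
    · intro T _ T' _ h
      simp only [Prod.mk.injEq] at h
      have : symmDiff T Jn = symmDiff T' Jn := by
        rw [← Finset.inter_univ (symmDiff T Jn), ← Finset.inter_univ (symmDiff T' Jn),
          ← Finset.union_compl J, Finset.inter_union_distrib_left,
          Finset.inter_union_distrib_left, h.1, h.2]
      exact symmDiff_left_injective Jn this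
  rw [Finset.card_product, Finset.card_powerset, Finset.card_compl] at hle
  refine (Nat.mul_le_mul_left p hle).trans ?_
  rw [← mul_assoc]
  exact Nat.mul_le_mul_right _ (card_powerset_dvd_le J hp _)

theorem card_signs_dvd_le_real {ι : Type*} [Fintype ι] [DecidableEq ι] (J : Finset ι) {p c : ℕ}
    (hp : Odd p) (hc : 0 < c) (hcJ : c ≤ J.card) (a : ℤ) (ε : ι → ℤ)
    (hε : ∀ i, ε i = 1 ∨ ε i = -1) :
    ((Finset.univ.filter fun T : Finset ι =>
      (p : ℤ) ∣ a - 2 * ∑ i ∈ T ∩ J, ε i).card : ℝ) ≤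
      (1 / p + 1 / √c) * 2 ^ Fintype.card ι := by
  have h := card_signs_dvd_le J hp a ε hε
  have hp0 : (0 : ℝ) < p := by exact_mod_cast hp.pos
  have h' : (p : ℝ) * ((Finset.univ.filter fun T : Finset ι =>
      (p : ℤ) ∣ a - 2 * ∑ i ∈ T ∩ J, ε i).card : ℝ) ≤
      (2 ^ J.card + p * J.card.choose (J.card / 2)) * 2 ^ (Fintype.card ι - J.card) := by
    exact_mod_cast h
  have h2 := choose_half_div_le hc hcJ
  rw [div_le_iff₀ (by positivity)] at h2
  refine le_of_mul_le_mul_left (h'.trans ?_) hp0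
  rw [← Nat.sub_add_cancel (Finset.card_le_univ J), pow_add, Nat.add_sub_cancel]
  calc (2 ^ J.card + (p : ℝ) * J.card.choose (J.card / 2)) * 2 ^ (Fintype.card ι - J.card)
      ≤ (2 ^ J.card + (p : ℝ) * (1 / √c * 2 ^ J.card)) * 2 ^ (Fintype.card ι - J.card) := by
        gcongr
    _ = _ := by field_simp

theorem sum_one_div_odd_sq_le (n : ℕ) :
    ∑ i ∈ Finset.range n, (1 : ℝ) / ((2 * i + 3 : ℕ) : ℝ) ^ 2 ≤ 1 / 4 - 1 / (4 * (n + 1)) := by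
  induction n with
  | zero => simp
  | succ n ih =>
    rw [Finset.sum_range_succ]
    have : (1 : ℝ) / ((2 * n + 3 : ℕ) : ℝ) ^ 2 ≤ 1 / (4 * (n + 1)) - 1 / (4 * ((n + 1 : ℕ) + 1)) := by
      rw [div_sub_div _ _ (by positivity) (by positivity), div_le_div_iff₀ (by positivity)
        (by positivity)]
      push_cast
      nlinarith
    linarith

theorem sum_odd_primes_sq_le (s : ℕ) {δ : ℝ} :
    ∑ p ∈ (Finset.range (s + 1)).filter (fun p => p.Prime ∧ Odd p), (1 / (p : ℝ) + δ) ^ 2 ≤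
      1 / 2 + 2 * δ ^ 2 * s.primeCounting := by
  set P := (Finset.range (s + 1)).filter (fun p => p.Prime ∧ Odd p)
  have h1 : ∑ p ∈ P, (1 / (p : ℝ)) ^ 2 ≤ 1 / 4 := by
    have hsub : P ⊆ (Finset.range s).image (fun i => 2 * i + 3) := by
      intro p hp
      simp only [P, Finset.mem_filter, Finset.mem_range, Finset.mem_image] at hp ⊢
      obtain ⟨h1, h2, ⟨k, hk⟩⟩ := hp
      have := h2.two_le
      exact ⟨k - 1, by omega, by omega⟩
    calc ∑ p ∈ P, (1 / (p : ℝ)) ^ 2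
        ≤ ∑ p ∈ ((Finset.range s).image (fun i => 2 * i + 3) : Finset ℕ), (1 / (p : ℝ)) ^ 2 :=
          Finset.sum_le_sum_of_subset_of_nonneg hsub fun _ _ _ => by positivity
      _ = ∑ i ∈ Finset.range s, (1 : ℝ) / ((2 * i + 3 : ℕ) : ℝ) ^ 2 := by
          rw [Finset.sum_image fun a _ b _ h => by simpa using h]
          simp
      _ ≤ 1 / 4 - 1 / (4 * ((s : ℝ) + 1)) := sum_one_div_odd_sq_le s
      _ ≤ 1 / 4 := by
          have : (0 : ℝ) ≤ 1 / (4 * ((s : ℝ) + 1)) := by positivity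
          linarith
  have h2 : (P.card : ℝ) ≤ s.primeCounting := by
    have : P.card ≤ s.primeCounting := by
      rw [← Nat.primesLE_card_eq_primeCounting]
      refine Finset.card_le_card fun p hp => ?_
      simp only [P, Finset.mem_filter, Finset.mem_range] at hp
      exact Nat.mem_primesLE.2 ⟨by omega, hp.2.1⟩
    exact_mod_cast this
  calc ∑ p ∈ P, (1 / (p : ℝ) + δ) ^ 2 ≤ ∑ p ∈ P, (2 * (1 / (p : ℝ)) ^ 2 + 2 * δ ^ 2) :=
        Finset.sum_le_sum fun p _ => by nlinarith [sq_nonneg (1 / (p : ℝ) - δ)]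
    _ = 2 * ∑ p ∈ P, (1 / (p : ℝ)) ^ 2 + 2 * δ ^ 2 * P.card := by
        rw [Finset.sum_add_distrib, ← Finset.mul_sum, Finset.sum_const, nsmul_eq_mul]; ring
    _ ≤ 2 * (1 / 4) + 2 * δ ^ 2 * s.primeCounting := by gcongr
    _ = _ := by ring

theorem eventually_primeCounting_le_mul {ε : ℝ} (hε : 0 < ε) :
    ∀ᶠ s : ℕ in atTop, (s.primeCounting : ℝ) ≤ ε * s := by
  have h := (Chebyshev.eventually_primeCounting_le one_pos).and
    ((Real.tendsto_log_atTop.eventually_ge_atTop ((Real.log 4 + 1) / ε)).and (eventually_gt_atTop 1))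
  filter_upwards [tendsto_natCast_atTop_atTop.eventually h] with s ⟨h1, h2, h3⟩
  rw [Nat.floor_natCast] at h1
  refine h1.trans ?_
  have hlog : 0 < Real.log s := Real.log_pos h3
  rw [div_le_iff₀ hlog]
  rw [div_le_iff₀ hε] at h2
  nlinarith

theorem exists_odd_prime_dvd {a b : ℤ} {s : ℕ} (ha : Odd a) (has : a.natAbs ≤ s)
    (h : Int.gcd a b ≠ 1) :
    ∃ p ∈ (Finset.range (s + 1)).filter (fun p => p.Prime ∧ Odd p), (p : ℤ) ∣ a ∧ (p : ℤ) ∣ b := by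
  obtain ⟨p, hp, hpd⟩ := Nat.exists_prime_and_dvd h
  have hpa : (p : ℤ) ∣ a := (Int.natCast_dvd_natCast.2 hpd).trans (Int.gcd_dvd_left ..)
  have hpb : (p : ℤ) ∣ b := (Int.natCast_dvd_natCast.2 hpd).trans (Int.gcd_dvd_right ..)
  refine ⟨p, ?_, hpa, hpb⟩
  have ha0 : a ≠ 0 := by rintro rfl; simp at ha
  have hle : p ≤ a.natAbs :=
    Nat.le_of_dvd (Int.natAbs_pos.2 ha0) (Int.natCast_dvd.1 hpa)
  simp only [Finset.mem_filter, Finset.mem_range]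
  refine ⟨by omega, hp, ?_⟩
  have : Odd (p : ℤ) := by
    obtain ⟨c, rfl⟩ := hpa
    exact (Int.odd_mul.1 ha).1
  exact_mod_cast this

/-- If each point of `X` is mapped into `B` by at most a proportion `q` of the permutations
`Φ T` of `X`, then `B` has at most a proportion `q` of the points of `X`. -/
theorem card_filter_le_of_actions {β I : Type*} [Fintype I] [Nonempty I] (X : Finset β)
    (Φ : I → β → β) (hmaps : ∀ T, ∀ w ∈ X, Φ T w ∈ X) (hinv : ∀ T w, Φ T (Φ T w) = w)
    (B : β → Prop) [DecidablePred B] {q : ℝ}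
    (hq : ∀ w ∈ X, ((Finset.univ.filter fun T => B (Φ T w)).card : ℝ) ≤ q * Fintype.card I) :
    ((X.filter B).card : ℝ) ≤ q * X.card := by
  have h1 : ∀ T, (X.filter fun w => B (Φ T w)).card = (X.filter B).card := fun T => by
    refine Finset.card_nbij' (Φ T) (Φ T) ?_ ?_ (fun w _ => hinv T w) fun w _ => hinv T w
    · intro w hw
      simp only [Finset.coe_filter, Set.mem_ofPred_eq] at hw ⊢
      exact ⟨hmaps T w hw.1, hw.2⟩
    · intro w hw
      simp only [Finset.coe_filter, Set.mem_ofPred_eq] at hw ⊢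
      exact ⟨hmaps T w hw.1, by rw [hinv]; exact hw.2⟩
  have h2 : Fintype.card I * (X.filter B).card =
      ∑ w ∈ X, (Finset.univ.filter fun T => B (Φ T w)).card := by
    simp_rw [Finset.card_filter]
    rw [Finset.sum_comm]
    simp_rw [← Finset.card_filter, h1]
    simp
  have hI : (0 : ℝ) < Fintype.card I := by exact_mod_cast Fintype.card_pos
  refine le_of_mul_le_mul_left ?_ hI
  calc (Fintype.card I : ℝ) * (X.filter B).card
      = ∑ w ∈ X, ((Finset.univ.filter fun T => B (Φ T w)).card : ℝ) := by exact_mod_cast h2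
    _ ≤ ∑ w ∈ X, q * Fintype.card I := Finset.sum_le_sum hq
    _ = _ := by rw [Finset.sum_const, nsmul_eq_mul]; ring

section Words

variable {α : Type*}

/-- The exponent `1` or `-1` of a letter, given its sign. -/
def signVal (b : Bool) : ℤ := bif b then 1 else -1

theorem signVal_eq (b : Bool) : signVal b = 1 ∨ signVal b = -1 := by cases b <;> simp [signVal]

theorem signVal_not (b : Bool) : signVal (!b) = signVal b - 2 * signVal b := by
  cases b <;> simp [signVal]

/-- No two consecutive letters of the word are mutually inverse. -/
def IsReducedFn {s : ℕ} (w : Fin s → α × Bool) : Prop :=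
  ∀ i j : Fin s, j.val = i.val + 1 → (w i).1 = (w j).1 → (w i).2 = (w j).2

/-- The position `i` of the word `w` carries the generator `k`, and no neighbour of it does.
The first three positions are excluded. -/
def IsIsolated {s : ℕ} (k : α) (w : Fin s → α × Bool) (i : Fin s) : Prop :=
  3 ≤ i.val ∧ (w i).1 = k ∧
    ∀ j : Fin s, (j.val = i.val + 1 ∨ i.val = j.val + 1) → (w j).1 ≠ k

open Classical in
/-- The positions of the isolated occurrences of `k`. -/
noncomputable def isolated {s : ℕ} (k : α) (w : Fin s → α × Bool) : Finset (Fin s) :=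
  Finset.univ.filter (IsIsolated k w)

theorem mem_isolated {s : ℕ} {k : α} {w : Fin s → α × Bool} {i : Fin s} :
    i ∈ isolated k w ↔ IsIsolated k w i := by simp [isolated]

/-- Invert the letters of `w` in the positions belonging to `A`. -/
def flipSigns {s : ℕ} (A : Finset (Fin s)) (w : Fin s → α × Bool) : Fin s → α × Bool :=
  fun i => if i ∈ A then ((w i).1, !(w i).2) else w i

@[simp]
theorem flipSigns_fst {s : ℕ} (A : Finset (Fin s)) (w : Fin s → α × Bool) (i : Fin s) :
    (flipSigns A w i).1 = (w i).1 := by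
  unfold flipSigns; split_ifs <;> rfl

theorem flipSigns_flipSigns {s : ℕ} (A : Finset (Fin s)) (w : Fin s → α × Bool) :
    flipSigns A (flipSigns A w) = w := by
  funext i
  by_cases h : i ∈ A <;> simp [flipSigns, h]

theorem isIsolated_flipSigns {s : ℕ} (A : Finset (Fin s)) (k : α) (w : Fin s → α × Bool)
    (i : Fin s) : IsIsolated k (flipSigns A w) i ↔ IsIsolated k w i := by
  simp [IsIsolated]

theorem isolated_flipSigns {s : ℕ} (A : Finset (Fin s)) (k : α) (w : Fin s → α × Bool) :
    isolated k (flipSigns A w) = isolated k w := by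
  ext i; simp [mem_isolated, isIsolated_flipSigns]

theorem IsReducedFn.flipSigns {s : ℕ} {A : Finset (Fin s)} {w : Fin s → α × Bool}
    (hw : IsReducedFn w) (hA : ∀ i ∈ A, ∃ k, IsIsolated k w i) :
    IsReducedFn (flipSigns A w) := by
  intro i j hij
  rw [flipSigns_fst, flipSigns_fst]
  intro h
  have hi : i ∉ A := fun hi => by
    obtain ⟨k, -, h1, h2⟩ := hA i hi
    exact h2 j (Or.inl hij) (h ▸ h1)
  have hj : j ∉ A := fun hj => by
    obtain ⟨k, -, h1, h2⟩ := hA j hj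
    exact h2 i (Or.inr hij) (h ▸ h1)
  simpa [_root_.flipSigns, hi, hj] using hw i j hij h

/-- Invert, among the isolated occurrences of `x` and of `y`, those in the positions belonging
to `T.1` and to `T.2` respectively. -/
noncomputable def flipIsolated {s : ℕ} (x y : α) (T : Finset (Fin s) × Finset (Fin s))
    (w : Fin s → α × Bool) : Fin s → α × Bool :=
  flipSigns (T.1 ∩ isolated x w ∪ T.2 ∩ isolated y w) w

theorem flipIsolated_flipIsolated {s : ℕ} (x y : α) (T : Finset (Fin s) × Finset (Fin s))
    (w : Fin s → α × Bool) : flipIsolated x y T (flipIsolated x y T w) = w := by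
  simp only [flipIsolated, isolated_flipSigns, flipSigns_flipSigns]

theorem IsReducedFn.flipIsolated {s : ℕ} {x y : α} {T : Finset (Fin s) × Finset (Fin s)}
    {w : Fin s → α × Bool} (hw : IsReducedFn w) : IsReducedFn (flipIsolated x y T w) := by
  refine hw.flipSigns fun i hi => ?_
  simp only [Finset.mem_union, Finset.mem_inter, mem_isolated] at hi
  exact hi.elim (fun h => ⟨x, h.2⟩) fun h => ⟨y, h.2⟩

variable [DecidableEq α]

/-- The exponent sum of the generator `k` in the word `w`. -/
def expSum {s : ℕ} (k : α) (w : Fin s → α × Bool) : ℤ :=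
  ∑ i, if (w i).1 = k then signVal (w i).2 else 0

theorem natAbs_expSum_le {s : ℕ} (k : α) (w : Fin s → α × Bool) : (expSum k w).natAbs ≤ s := by
  have h : |expSum k w| ≤ s := by
    refine (Finset.abs_sum_le_sum_abs _ _).trans ?_
    refine (Finset.sum_le_card_nsmul _ _ 1 fun i _ => ?_).trans (by simp)
    split_ifs
    · rcases signVal_eq (w i).2 with h | h <;> simp [h]
    · simp
  rw [← Int.natCast_natAbs] at h
  exact_mod_cast h

theorem expSum_flipSigns {s : ℕ} (A : Finset (Fin s)) (k : α) (w : Fin s → α × Bool) :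
    expSum k (flipSigns A w) =
      expSum k w - 2 * ∑ i ∈ A.filter fun i => (w i).1 = k, signVal (w i).2 := by
  rw [expSum, expSum, ← Finset.univ_inter A, ← Finset.filter_mem_eq_inter, Finset.filter_filter,
    Finset.sum_filter, Finset.mul_sum, ← Finset.sum_sub_distrib]
  refine Finset.sum_congr rfl fun i _ => ?_
  by_cases h : (w i).1 = k <;> by_cases h2 : i ∈ A <;> simp [h, h2, flipSigns, signVal_not]

theorem expSum_flipIsolated_left {s : ℕ} {x y : α} (hxy : x ≠ y)
    (T : Finset (Fin s) × Finset (Fin s)) (w : Fin s → α × Bool) :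
    expSum x (flipIsolated x y T w) =
      expSum x w - 2 * ∑ i ∈ T.1 ∩ isolated x w, signVal (w i).2 := by
  rw [flipIsolated, expSum_flipSigns]
  congr 3
  ext i
  simp only [Finset.mem_filter, Finset.mem_union, Finset.mem_inter, mem_isolated]
  refine ⟨fun ⟨h, hx⟩ => h.resolve_right fun h => hxy (hx.symm.trans h.2.2.1),
    fun h => ⟨Or.inl h, h.2.2.1⟩⟩

theorem expSum_flipIsolated_right {s : ℕ} {x y : α} (hxy : x ≠ y)
    (T : Finset (Fin s) × Finset (Fin s)) (w : Fin s → α × Bool) :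
    expSum y (flipIsolated x y T w) =
      expSum y w - 2 * ∑ i ∈ T.2 ∩ isolated y w, signVal (w i).2 := by
  rw [flipIsolated, expSum_flipSigns]
  congr 3
  ext i
  simp only [Finset.mem_filter, Finset.mem_union, Finset.mem_inter, mem_isolated]
  refine ⟨fun ⟨h, hx⟩ => h.resolve_left fun h => hxy (h.2.2.1.symm.trans hx),
    fun h => ⟨Or.inr h, h.2.2.1⟩⟩

/-- Random flips of isolated occurrences make the exponent sums of `x` and `y` coprime with
probability close to at least `1 / 2`. -/
theorem card_flips_gcd_ne_one_le {s c : ℕ} (hc : 0 < c) {x y : α} (hxy : x ≠ y)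
    (w : Fin s → α × Bool) (hodd : Odd (expSum x w)) (hx : c ≤ (isolated x w).card)
    (hy : c ≤ (isolated y w).card) :
    ((Finset.univ.filter fun T : Finset (Fin s) × Finset (Fin s) =>
      Int.gcd (expSum x (flipIsolated x y T w)) (expSum y (flipIsolated x y T w)) ≠ 1).card : ℝ) ≤
      (1 / 2 + 2 * s.primeCounting / c) *
        Fintype.card (Finset (Fin s) × Finset (Fin s)) := by
  set P := (Finset.range (s + 1)).filter (fun p => p.Prime ∧ Odd p) with hP
  set B : α → ℕ → Finset (Finset (Fin s)) := fun k p =>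
    Finset.univ.filter fun T : Finset (Fin s) =>
      (p : ℤ) ∣ expSum k w - 2 * ∑ i ∈ T ∩ isolated k w, signVal (w i).2 with hB
  have hsub : (Finset.univ.filter fun T : Finset (Fin s) × Finset (Fin s) =>
      Int.gcd (expSum x (flipIsolated x y T w)) (expSum y (flipIsolated x y T w)) ≠ 1) ⊆
      P.biUnion fun p => B x p ×ˢ B y p := by
    intro T hT
    replace hT := (Finset.mem_filter.1 hT).2
    obtain ⟨p, hp, h1, h2⟩ := exists_odd_prime_dvd (by
      rw [expSum_flipIsolated_left hxy]
      exact hodd.sub_even (even_two_mul _)) (natAbs_expSum_le _ _) hT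
    rw [expSum_flipIsolated_left hxy] at h1
    rw [expSum_flipIsolated_right hxy] at h2
    simp only [Finset.mem_biUnion, Finset.mem_product, hB, Finset.mem_filter, Finset.mem_univ,
      true_and]
    exact ⟨p, hp, h1, h2⟩
  have hcard : ∀ k, c ≤ (isolated k w).card → ∀ p ∈ P,
      ((B k p).card : ℝ) ≤ (1 / p + 1 / √c) * 2 ^ s := fun k hk p hp => by
    have := card_signs_dvd_le_real (isolated k w) (Finset.mem_filter.1 hp).2.2 hc hk (expSum k w)
      (fun i => signVal (w i).2) fun i => signVal_eq _
    rwa [Fintype.card_fin] at this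
  calc _ ≤ ((∑ p ∈ P, (B x p ×ˢ B y p).card : ℕ) : ℝ) := by
        exact_mod_cast (Finset.card_le_card hsub).trans Finset.card_biUnion_le
    _ = ∑ p ∈ P, ((B x p).card : ℝ) * (B y p).card := by
        push_cast [Finset.card_product]; rfl
    _ ≤ ∑ p ∈ P, ((1 / (p : ℝ) + 1 / √c) * 2 ^ s) * ((1 / p + 1 / √c) * 2 ^ s) := by
        refine Finset.sum_le_sum fun p hp => ?_
        gcongr
        · exact hcard x hx p hp
        · exact hcard y hy p hp
    _ = (∑ p ∈ P, (1 / (p : ℝ) + 1 / √c) ^ 2) * (2 ^ s * 2 ^ s) := by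
        rw [Finset.sum_mul]
        exact Finset.sum_congr rfl fun p _ => by ring
    _ ≤ (1 / 2 + 2 * (1 / √c) ^ 2 * s.primeCounting) * (2 ^ s * 2 ^ s) := by
        gcongr
        exact sum_odd_primes_sq_le s
    _ = _ := by
        rw [Fintype.card_prod, Fintype.card_finset, Fintype.card_fin, div_pow,
          Real.sq_sqrt (by positivity)]
        push_cast
        ring

end Words

section Density

variable {α : Type*}

/-- The positions of the isolated occurrences of `x` that are directly followed by an isolated
occurrence of `y`. -/
noncomputable def isolatedPairs {s : ℕ} (x y : α) (w : Fin s → α × Bool) : Finset (Fin s) :=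
  (isolated x w).filter fun i => ∃ j ∈ isolated y w, j.val = i.val + 1

theorem card_isolatedPairs_le_left {s : ℕ} (x y : α) (w : Fin s → α × Bool) :
    (isolatedPairs x y w).card ≤ (isolated x w).card :=
  Finset.card_le_card (Finset.filter_subset _ _)

theorem card_isolatedPairs_le_right {s : ℕ} (x y : α) (w : Fin s → α × Bool) :
    (isolatedPairs x y w).card ≤ (isolated y w).card := by
  have h : ∀ i ∈ isolatedPairs x y w, ∃ j ∈ isolated y w, j.val = i.val + 1 :=
    fun i hi => (Finset.mem_filter.1 hi).2
  refine Finset.card_le_card_of_forall_subsingleton (fun i j => j.val = i.val + 1) h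
    fun j _ i hi i' hi' => Fin.ext ?_
  have h1 := hi.2
  have h2 := hi'.2
  omega

theorem isolatedPairs_flipIsolated {s : ℕ} (x y : α) (T : Finset (Fin s) × Finset (Fin s))
    (w : Fin s → α × Bool) :
    isolatedPairs x y (flipIsolated x y T w) = isolatedPairs x y w := by
  simp only [isolatedPairs, flipIsolated, isolated_flipSigns]

theorem IsIsolated.congr {s : ℕ} {k : α} {w w' : Fin s → α × Bool} {i : Fin s}
    (h : IsIsolated k w i) (hw : ∀ j : Fin s, 2 ≤ j.val → w' j = w j) : IsIsolated k w' i := by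
  obtain ⟨h1, h2, h3⟩ := h
  refine ⟨h1, by rwa [hw i (by omega)], fun j hj => ?_⟩
  rw [hw j (by omega)]
  exact h3 j hj

theorem isolatedPairs_subset {s : ℕ} {x y : α} {w w' : Fin s → α × Bool}
    (hw : ∀ j : Fin s, 2 ≤ j.val → w' j = w j) : isolatedPairs x y w ⊆ isolatedPairs x y w' := by
  intro i hi
  simp only [isolatedPairs, Finset.mem_filter, mem_isolated] at hi ⊢
  obtain ⟨h1, j, h2, h3⟩ := hi
  exact ⟨h1.congr hw, j, h2.congr hw, h3⟩

/-- Rewriting four letters of a reduced word creates an isolated `x` followed by an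
isolated `y`. -/
theorem exists_mem_isolatedPairs {s : ℕ} {x y : α} (hxy : x ≠ y) {w : Fin s → α × Bool}
    (hw : IsReducedFn w) {i : Fin s} (hi : 3 ≤ i.val) (his : i.val + 2 < s) :
    ∃ w' : Fin s → α × Bool, IsReducedFn w' ∧ i ∈ isolatedPairs x y w' ∧
      ∀ j : Fin s, ¬(i.val ≤ j.val + 1 ∧ j.val ≤ i.val + 2) → w' j = w j := by
  set w' : Fin s → α × Bool := fun j =>
    if j.val + 1 = i.val then (y, (w ⟨i.val - 2, by omega⟩).2)
    else if j.val = i.val then (x, true)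
    else if j.val = i.val + 1 then (y, true)
    else if j.val = i.val + 2 then
      (x, if h : i.val + 3 < s then (w ⟨i.val + 3, h⟩).2 else true)
    else w j with hw'
  have e0 : ∀ j : Fin s, j.val + 1 = i.val → w' j = (y, (w ⟨i.val - 2, by omega⟩).2) :=
    fun j hj => by simp only [hw']; rw [if_pos hj]
  have e1 : ∀ j : Fin s, j.val = i.val → w' j = (x, true) :=
    fun j hj => by simp only [hw']; rw [if_neg (by omega), if_pos hj]
  have e2 : ∀ j : Fin s, j.val = i.val + 1 → w' j = (y, true) :=
    fun j hj => by simp only [hw']; rw [if_neg (by omega), if_neg (by omega), if_pos hj]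
  have e3 : ∀ j : Fin s, j.val = i.val + 2 →
      w' j = (x, if h : i.val + 3 < s then (w ⟨i.val + 3, h⟩).2 else true) :=
    fun j hj => by
      simp only [hw']; rw [if_neg (by omega), if_neg (by omega), if_neg (by omega), if_pos hj]
  have e4 : ∀ j : Fin s, ¬(i.val ≤ j.val + 1 ∧ j.val ≤ i.val + 2) → w' j = w j :=
    fun j hj => by
      simp only [hw']
      rw [if_neg (by omega), if_neg (by omega), if_neg (by omega), if_neg (by omega)]
  refine ⟨w', ?_, ?_, e4⟩
  · intro j l hjl
    by_cases h0 : j.val + 2 = i.val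
    · rw [e4 j (by omega), e0 l (by omega)]
      intro _
      have hj : j = ⟨i.val - 2, by omega⟩ := Fin.ext (by simp only; omega)
      exact congrArg (fun t => (w t).2) hj
    by_cases h1 : j.val + 1 = i.val
    · rw [e0 j h1, e1 l (by omega)]
      exact fun h => absurd h.symm hxy
    by_cases h2 : j.val = i.val
    · rw [e1 j h2, e2 l (by omega)]
      exact fun h => absurd h hxy
    by_cases h3 : j.val = i.val + 1
    · rw [e2 j h3, e3 l (by omega)]
      exact fun h => absurd h.symm hxy
    by_cases h4 : j.val = i.val + 2
    · rw [e3 j h4, e4 l (by omega)]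
      intro _
      have hl : l = ⟨i.val + 3, by omega⟩ := Fin.ext (by simp; omega)
      rw [dif_pos (by omega)]
      exact congrArg (fun t => (w t).2) hl.symm
    rw [e4 j (by omega), e4 l (by omega)]
    exact hw j l hjl
  · simp only [isolatedPairs, Finset.mem_filter, mem_isolated]
    refine ⟨⟨hi, by rw [e1 i rfl], ?_⟩, ⟨i.val + 1, by omega⟩,
      ⟨by simp; omega, by rw [e2 _ rfl], ?_⟩, rfl⟩
    · rintro j (hj | hj)
      · rw [e2 j hj]; exact hxy.symm
      · rw [e0 j hj.symm]; exact hxy.symm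
    · rintro j (hj | hj)
      · rw [e3 j hj]; exact hxy
      · rw [e1 j (by simp at hj; omega)]; exact hxy

/-- Rewriting the first two letters of a reduced word makes the exponent sum of `x` odd. -/
theorem exists_odd_expSum [DecidableEq α] {s : ℕ} {x y : α} (hxy : x ≠ y)
    {w : Fin s → α × Bool} (hw : IsReducedFn w) (hs : 3 ≤ s) :
    ∃ w' : Fin s → α × Bool, IsReducedFn w' ∧ Odd (expSum x w') ∧
      ∀ j : Fin s, 2 ≤ j.val → w' j = w j := by
  set b := (w ⟨2, hs⟩).2 with hb
  set v : α → Fin s → α × Bool := fun k j =>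
    if j.val = 0 then (y, b) else if j.val = 1 then (k, b) else w j with hv
  have e2 : ∀ k, ∀ j : Fin s, 2 ≤ j.val → v k j = w j := fun k j hj => by
    simp only [hv]; rw [if_neg (by omega), if_neg (by omega)]
  have e1 : ∀ k, ∀ j : Fin s, j.val ≤ 2 → (v k j).2 = b := fun k j hj => by
    by_cases h2 : j.val = 2
    · rw [e2 k j h2.ge, show j = ⟨2, hs⟩ from Fin.ext h2]
    · simp only [hv]
      split_ifs <;> first | rfl | omega
  have hred : ∀ k, IsReducedFn (v k) := fun k i j hij h => by
    rcases Nat.lt_or_ge i.val 2 with hi | hi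
    · rw [e1 k i (by omega), e1 k j (by omega)]
    · rw [e2 k i hi, e2 k j (by omega)] at h ⊢
      exact hw i j hij h
  have hdiff : expSum x (v x) - expSum x (v y) = signVal b := by
    rw [expSum, expSum, ← Finset.sum_sub_distrib,
      Finset.sum_eq_single ⟨1, by omega⟩]
    · simp [hv, hxy.symm]
    · intro j _ hj
      have hj1 : j.val ≠ 1 := fun h => hj (Fin.ext h)
      simp [hv, hj1]
    · simp
  have hodd : Odd (signVal b) := by rcases signVal_eq b with h | h <;> rw [h] <;> decide
  by_cases hx : Odd (expSum x (v x))
  · exact ⟨v x, hred x, hx, e2 x⟩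
  · refine ⟨v y, hred y, ?_, e2 y⟩
    have : expSum x (v y) = expSum x (v x) - signVal b := by rw [← hdiff]; ring
    rw [this]
    exact (Int.not_odd_iff_even.1 hx).sub_odd hodd

/-- If each word of `P` becomes a word of `Q` after rewriting the letters in the positions
belonging to `W`, then `P` is not much larger than `Q`. -/
theorem card_le_of_rewrite {ι β : Type*} [Finite ι] [Fintype β] [Nonempty β]
    (P Q : Finset (ι → β))
    (W : Finset ι) {L : ℕ} (hW : W.card ≤ L)
    (h : ∀ w ∈ P, ∃ w' ∈ Q, ∀ i ∉ W, w' i = w i) :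
    P.card ≤ Fintype.card β ^ L * Q.card := by
  classical
  choose! f hfQ hf using h
  have hle : P.card ≤ (Q ×ˢ (Finset.univ : Finset (W → β))).card := by
    refine Finset.card_le_card_of_injOn (fun w => (f w, fun i => w i)) ?_ ?_
    · intro w hw
      simp [hfQ w hw]
    · intro w hw w' hw' heq
      simp only [Prod.mk.injEq] at heq
      funext i
      by_cases hi : i ∈ W
      · exact congrFun heq.2 ⟨i, hi⟩
      · rw [← hf w hw i hi, ← hf w' hw' i hi, heq.1]
  rw [Finset.card_product, Finset.card_univ, Fintype.card_fun, Fintype.card_coe, mul_comm] at hle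
  exact hle.trans (Nat.mul_le_mul_right _ (Nat.pow_le_pow_right Fintype.card_pos hW))
open Classical in
/-- The reduced words of length `s`. -/
noncomputable def reducedFns (α : Type*) [Fintype α] (s : ℕ) : Finset (Fin s → α × Bool) :=
  Finset.univ.filter IsReducedFn

theorem mem_reducedFns [Fintype α] {s : ℕ} {w : Fin s → α × Bool} :
    w ∈ reducedFns α s ↔ IsReducedFn w := by simp [reducedFns]

theorem card_reducedFns_le_filter_isolatedPairs [Fintype α] {s : ℕ} {x y : α} (hxy : x ≠ y)
    {i : Fin s} (hi : 3 ≤ i.val) (his : i.val + 2 < s) :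
    (reducedFns α s).card ≤ Fintype.card (α × Bool) ^ 4 *
      ((reducedFns α s).filter fun w => i ∈ isolatedPairs x y w).card := by
  have : Nonempty α := ⟨x⟩
  refine card_le_of_rewrite _ _
    (Finset.univ.filter fun j : Fin s => i.val ≤ j.val + 1 ∧ j.val ≤ i.val + 2) ?_ ?_
  · have : 4 = (Finset.Icc (i.val - 1) (i.val + 2)).card := by rw [Nat.card_Icc]; omega
    rw [this]
    refine Finset.card_le_card_of_injOn (fun j : Fin s => j.val) ?_ fun a _ b _ => Fin.ext
    intro j hj
    simp at hj ⊢
    omega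
  · intro w hw
    obtain ⟨w', h1, h2, h3⟩ := exists_mem_isolatedPairs hxy (mem_reducedFns.1 hw) hi his
    refine ⟨w', Finset.mem_filter.2 ⟨mem_reducedFns.2 h1, h2⟩, fun j hj => h3 j ?_⟩
    simpa using hj

theorem mul_card_reducedFns_le_sum [Fintype α] {s : ℕ} {x y : α} (hxy : x ≠ y) :
    (s - 5) * (reducedFns α s).card ≤
      Fintype.card (α × Bool) ^ 4 * ∑ w ∈ reducedFns α s, (isolatedPairs x y w).card := by
  classical
  set I := Finset.univ.filter fun i : Fin s => 3 ≤ i.val ∧ i.val + 2 < s with hI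
  have hcard : s - 5 ≤ I.card := by
    calc s - 5 = (Finset.Ico 3 (s - 2)).card := by rw [Nat.card_Ico]; omega
      _ ≤ (I.image fun i : Fin s => i.val).card := by
        refine Finset.card_le_card fun j hj => ?_
        rw [Finset.mem_Ico] at hj
        simp only [hI, Finset.mem_image, Finset.mem_filter, Finset.mem_univ, true_and]
        exact ⟨⟨j, by omega⟩, ⟨hj.1, by simp only; omega⟩, rfl⟩
      _ ≤ I.card := Finset.card_image_le
  have hsum : ∑ w ∈ reducedFns α s, (isolatedPairs x y w).card =
      ∑ i : Fin s, ((reducedFns α s).filter fun w => i ∈ isolatedPairs x y w).card := by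
    simp_rw [Finset.card_filter]
    rw [Finset.sum_comm]
    refine Finset.sum_congr rfl fun w _ => ?_
    rw [← Finset.card_filter, Finset.filter_mem_eq_inter, Finset.univ_inter]
  rw [hsum, Finset.mul_sum]
  calc (s - 5) * (reducedFns α s).card ≤ I.card * (reducedFns α s).card :=
        Nat.mul_le_mul_right _ hcard
    _ = ∑ i ∈ I, (reducedFns α s).card := by rw [Finset.sum_const, smul_eq_mul]
    _ ≤ ∑ i ∈ I, Fintype.card (α × Bool) ^ 4 *
          ((reducedFns α s).filter fun w => i ∈ isolatedPairs x y w).card :=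
        Finset.sum_le_sum fun i hi => by
          have := (Finset.mem_filter.1 hi).2
          exact card_reducedFns_le_filter_isolatedPairs hxy this.1 this.2
    _ ≤ _ := Finset.sum_le_sum_of_subset (Finset.subset_univ I)

/-- A positive proportion of the reduced words has linearly many isolated pairs. -/
theorem card_reducedFns_le_many_isolatedPairs [Fintype α] {s c : ℕ} (hs : 10 ≤ s) {x y : α}
    (hxy : x ≠ y) (hc : 4 * (Fintype.card (α × Bool) ^ 4 * c) ≤ s) :
    (reducedFns α s).card ≤ 4 * Fintype.card (α × Bool) ^ 4 *
      ((reducedFns α s).filter fun w => c ≤ (isolatedPairs x y w).card).card := by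
  set D := Fintype.card (α × Bool) ^ 4
  set R := reducedFns α s
  have h1 := mul_card_reducedFns_le_sum (s := s) hxy
  have h2 : ∑ w ∈ R, (isolatedPairs x y w).card ≤
      s * (R.filter fun w => c ≤ (isolatedPairs x y w).card).card + c * R.card := by
    calc ∑ w ∈ R, (isolatedPairs x y w).card
        ≤ ∑ w ∈ R, (s * (if c ≤ (isolatedPairs x y w).card then 1 else 0) + c) := by
          refine Finset.sum_le_sum fun w _ => ?_
          have : (isolatedPairs x y w).card ≤ s := by
            simpa using Finset.card_le_univ (isolatedPairs x y w)
          split_ifs <;> omega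
      _ = _ := by
          rw [Finset.sum_add_distrib, ← Finset.mul_sum, ← Finset.card_filter, Finset.sum_const,
            smul_eq_mul, mul_comm c]
  set X := (R.filter fun w => c ≤ (isolatedPairs x y w).card).card
  have h3 : (s - 5) * R.card ≤ D * (s * X + c * R.card) := h1.trans (Nat.mul_le_mul_left _ h2)
  have h4 : 2 * (s * R.card) ≤ 4 * ((s - 5) * R.card) := by
    calc 2 * (s * R.card) = (2 * s) * R.card := by ring
      _ ≤ (4 * (s - 5)) * R.card := Nat.mul_le_mul_right _ (by omega)
      _ = _ := by ring
  have h5 : 4 * (D * c) * R.card ≤ s * R.card := Nat.mul_le_mul_right _ hc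
  refine Nat.le_of_mul_le_mul_left (?_ : s * _ ≤ s * _) (by omega)
  nlinarith

theorem filter_isolatedPairs_card_le [Fintype α] [DecidableEq α] {s c : ℕ} (hs : 3 ≤ s)
    {x y : α} (hxy : x ≠ y) :
    ((reducedFns α s).filter fun w => c ≤ (isolatedPairs x y w).card).card ≤
      Fintype.card (α × Bool) ^ 2 * ((reducedFns α s).filter fun w =>
        c ≤ (isolatedPairs x y w).card ∧ Odd (expSum x w)).card := by
  have : Nonempty α := ⟨x⟩
  refine card_le_of_rewrite _ _ (Finset.univ.filter fun j : Fin s => j.val < 2) ?_ ?_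
  · calc _ ≤ (Finset.range 2).card :=
        Finset.card_le_card_of_injOn (fun j : Fin s => j.val) (fun j hj => by simpa using hj)
          fun a _ b _ => Fin.ext
      _ = 2 := by simp
  · intro w hw
    simp only [Finset.mem_filter, mem_reducedFns] at hw
    obtain ⟨w', h1, h2, h3⟩ := exists_odd_expSum hxy hw.1 hs
    refine ⟨w', Finset.mem_filter.2 ⟨mem_reducedFns.2 h1, ?_, h2⟩, fun j hj => h3 j ?_⟩
    · exact hw.2.trans (Finset.card_le_card (isolatedPairs_subset h3))
    · simpa only [Finset.mem_filter, Finset.mem_univ, true_and, not_lt] using hj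

/-- For a positive proportion of the reduced words, the exponent sums of two given generators
are coprime. -/
theorem eventually_card_reducedFns_le_gcd [Fintype α] [DecidableEq α] {x y : α} (hxy : x ≠ y) :
    ∀ᶠ s in atTop, (reducedFns α s).card ≤ 16 * Fintype.card (α × Bool) ^ 6 *
      ((reducedFns α s).filter fun w => Int.gcd (expSum x w) (expSum y w) = 1).card := by
  have : Nonempty α := ⟨x⟩
  set D := Fintype.card (α × Bool) with hD
  have hD0 : 0 < D := Fintype.card_pos
  have hε : (0 : ℝ) < 1 / (64 * D ^ 4) := by positivity
  filter_upwards [eventually_primeCounting_le_mul hε, eventually_ge_atTop 10,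
    eventually_ge_atTop (8 * D ^ 4)] with s hpi hs hsD
  set c := s / (4 * D ^ 4) with hc
  have hD4 : 0 < 4 * D ^ 4 := by positivity
  have hc1 : 4 * (D ^ 4 * c) ≤ s := by
    rw [← mul_assoc]; exact Nat.mul_div_le s _
  have hc2 : s ≤ 8 * D ^ 4 * c := by
    have h1 := Nat.lt_mul_div_succ s hD4
    rw [← hc] at h1
    nlinarith
  have hc0 : 0 < c := Nat.div_pos (by omega) hD4
  set X := (reducedFns α s).filter fun w => c ≤ (isolatedPairs x y w).card ∧ Odd (expSum x w)
    with hX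
  have hXR : (reducedFns α s).card ≤ 4 * D ^ 6 * X.card := by
    calc _ ≤ 4 * D ^ 4 * _ := card_reducedFns_le_many_isolatedPairs hs hxy hc1
      _ ≤ 4 * D ^ 4 * (D ^ 2 * X.card) :=
        Nat.mul_le_mul_left _ (filter_isolatedPairs_card_le (by omega) hxy)
      _ = _ := by ring
  have hq : 1 / 2 + 2 * (s.primeCounting : ℝ) / c ≤ 3 / 4 := by
    have hc0' : (0 : ℝ) < c := by exact_mod_cast hc0
    have hc2' : (s : ℝ) ≤ 8 * D ^ 4 * c := by exact_mod_cast hc2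
    have h8 : (s.primeCounting : ℝ) ≤ c / 8 := by
      refine hpi.trans ?_
      rw [one_div, inv_mul_le_iff₀ (by positivity)]
      linarith
    have : 2 * (s.primeCounting : ℝ) / c ≤ 1 / 4 := by
      rw [div_le_iff₀ hc0']; linarith
    linarith
  have hbad : ((X.filter fun w => Int.gcd (expSum x w) (expSum y w) ≠ 1).card : ℝ) ≤
      3 / 4 * X.card := by
    refine card_filter_le_of_actions X (flipIsolated x y) ?_ (flipIsolated_flipIsolated x y) _ ?_
    · intro T w hw
      simp only [hX, Finset.mem_filter, mem_reducedFns, isolatedPairs_flipIsolated] at hw ⊢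
      refine ⟨hw.1.flipIsolated, hw.2.1, ?_⟩
      rw [expSum_flipIsolated_left hxy]
      exact hw.2.2.sub_even (even_two_mul _)
    · intro w hw
      simp only [hX, Finset.mem_filter, mem_reducedFns] at hw
      refine (card_flips_gcd_ne_one_le hc0 hxy w hw.2.2
        (hw.2.1.trans (card_isolatedPairs_le_left x y w))
        (hw.2.1.trans (card_isolatedPairs_le_right x y w))).trans ?_
      gcongr
  have hgood : (X.filter fun w => Int.gcd (expSum x w) (expSum y w) = 1).card +
      (X.filter fun w => Int.gcd (expSum x w) (expSum y w) ≠ 1).card = X.card :=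
    Finset.card_filter_add_card_filter_not _
  have hsub : (X.filter fun w => Int.gcd (expSum x w) (expSum y w) = 1).card ≤
      ((reducedFns α s).filter fun w => Int.gcd (expSum x w) (expSum y w) = 1).card :=
    Finset.card_le_card (Finset.filter_subset_filter _ (Finset.filter_subset _ _))
  have hX4 : X.card ≤
      4 * ((reducedFns α s).filter fun w => Int.gcd (expSum x w) (expSum y w) = 1).card := by
    have h1 : ((X.filter fun w => Int.gcd (expSum x w) (expSum y w) = 1).card : ℝ) +
      (X.filter fun w => Int.gcd (expSum x w) (expSum y w) ≠ 1).card = X.card := by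
        exact_mod_cast hgood
    have h2 : (X.card : ℝ) ≤
      4 * (X.filter fun w => Int.gcd (expSum x w) (expSum y w) = 1).card := by linarith
    have h3 : X.card ≤
      4 * (X.filter fun w => Int.gcd (expSum x w) (expSum y w) = 1).card := by exact_mod_cast h2
    omega
  calc _ ≤ 4 * D ^ 6 * X.card := hXR
    _ ≤ 4 * D ^ 6 * (4 * _) := Nat.mul_le_mul_left _ hX4
    _ = _ := by ring

end Density

section Exponents

variable {α : Type*} [DecidableEq α]

/-- The exponent sum of the generator `x`, as a homomorphism. -/
def exponentHom (x : α) : FreeGroup α →* Multiplicative ℤ :=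
  FreeGroup.lift fun i => Multiplicative.ofAdd (if i = x then 1 else 0)

/-- The exponent sum of the generator `x` in an element of the free group. -/
def exponent (x : α) (z : FreeGroup α) : ℤ := (exponentHom x z).toAdd

theorem exponent_mul (x : α) (z w : FreeGroup α) :
    exponent x (z * w) = exponent x z + exponent x w := by simp [exponent]

theorem exponent_mk_nil (x : α) : exponent x (FreeGroup.mk []) = 0 := by
  simp [exponent, exponentHom]

theorem exponent_mk_cons (x i : α) (b : Bool) (L : List (α × Bool)) :
    exponent x (FreeGroup.mk ((i, b) :: L)) =
      (if i = x then signVal b else 0) + exponent x (FreeGroup.mk L) := by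
  cases b <;> by_cases h : i = x <;> simp [exponent, exponentHom, signVal, h]

theorem exponent_mk_append (x : α) (L L' : List (α × Bool)) :
    exponent x (FreeGroup.mk (L ++ L')) =
      exponent x (FreeGroup.mk L) + exponent x (FreeGroup.mk L') := by
  rw [← FreeGroup.mul_mk, exponent_mul]

theorem exponent_mk_ofFn (x : α) {s : ℕ} (w : Fin s → α × Bool) :
    exponent x (FreeGroup.mk (List.ofFn w)) = expSum x w := by
  induction s with
  | zero => simp [expSum, exponent_mk_nil]
  | succ s ih =>
    rw [List.ofFn_succ, show w 0 = ((w 0).1, (w 0).2) from rfl, exponent_mk_cons, ih, expSum,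
      expSum, Fin.sum_univ_succ]

/-- A homomorphism to `ℤ` is determined by the exponent sums. -/
theorem toAdd_eq_sum_exponent [Fintype α] (χ : FreeGroup α →* Multiplicative ℤ)
    (z : FreeGroup α) :
    (χ z).toAdd = ∑ i, exponent i z * (χ (FreeGroup.of i)).toAdd := by
  have : χ = ∏ i, (zpowersHom (Multiplicative ℤ) (χ (FreeGroup.of i))).comp (exponentHom i) := by
    ext j
    rw [MonoidHom.finsetProd_apply, Finset.prod_eq_single j]
    · simp [exponentHom]
    · intro i _ hij
      simp [exponentHom, hij.symm]
    · simp
  conv_lhs => rw [this]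
  rw [MonoidHom.finsetProd_apply, toAdd_prod]
  simp [exponent]

/-- An element with two coprime exponent sums can be mapped to any element of any group. -/
theorem exists_hom_of_gcd_eq_one {x y : α} {z : FreeGroup α}
    (h : Int.gcd (exponent x z) (exponent y z) = 1) {G : Type*} [Group G] (w : G) :
    ∃ φ : FreeGroup α →* G, φ z = w := by
  set a := Int.gcdA (exponent x z) (exponent y z)
  set b := Int.gcdB (exponent x z) (exponent y z)
  have hab := Int.gcd_eq_gcd_ab (exponent x z) (exponent y z)
  rw [h] at hab
  refine ⟨(zpowersHom G w).comp (exponentHom x ^ a * exponentHom y ^ b), ?_⟩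
  have : exponent x z * a + exponent y z * b = 1 := by rw [← hab]; rfl
  simp only [exponent] at this
  simp [mul_comm a, mul_comm b, this]

/-- Divisibility of all exponent sums is preserved under homomorphisms. -/
theorem dvd_exponent_map [Fintype α] {β : Type*} [DecidableEq β] {d : ℤ} {z : FreeGroup α}
    (hz : ∀ i, d ∣ exponent i z) (φ : FreeGroup α →* FreeGroup β) (j : β) :
    d ∣ exponent j (φ z) := by
  have h := toAdd_eq_sum_exponent ((exponentHom j).comp φ) z
  rw [exponent, ← MonoidHom.comp_apply, h]
  exact Finset.dvd_sum fun i _ => (hz i).mul_right _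

theorem exists_isReduced_cons {β : Type*} (y : β) {L : List (β × Bool)} (hL : FreeGroup.IsReduced L) :
    ∃ b, FreeGroup.IsReduced ((y, b) :: L) := by
  cases L with
  | nil => exact ⟨true, by simp⟩
  | cons p L => exact ⟨p.2, by simpa [FreeGroup.isReduced_cons_cons] using hL⟩

/-- A reduced word has a reduced extension by six letters to the left that adds a prescribed
amount modulo `3` to the exponent sum of `x`, and nothing to the other ones. -/
theorem exists_prefix_six {x y : α} (hxy : x ≠ y) {L : List (α × Bool)}
    (hL : FreeGroup.IsReduced L) (e : ℤ) :
    ∃ v : List (α × Bool), v.length = 6 ∧ FreeGroup.IsReduced (v ++ L) ∧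
      ∀ j, (3 : ℤ) ∣ exponent j (FreeGroup.mk v) - if j = x then e else 0 := by
  obtain ⟨b, hb⟩ := exists_isReduced_cons y hL
  have hfour : ∀ c : Bool, (3 : ℤ) ∣ 4 * signVal c - e →
      ∃ v : List (α × Bool), v.length = 6 ∧ FreeGroup.IsReduced (v ++ L) ∧
      ∀ j, (3 : ℤ) ∣ exponent j (FreeGroup.mk v) - if j = x then e else 0 := fun c hc => by
    refine ⟨[(y, !b), (x, c), (x, c), (x, c), (x, c), (y, b)], rfl, ?_, fun j => ?_⟩
    · simp [FreeGroup.isReduced_cons_cons, hxy, hxy.symm, hb]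
    · simp only [exponent_mk_cons, exponent_mk_nil]
      by_cases h1 : j = x
      · subst h1
        simp only [hxy.symm, if_true, if_false]
        convert hc using 1; ring
      · have h3 : ∀ d, signVal d + signVal (!d) = 0 := by decide
        have := h3 b
        by_cases h2 : y = j
        · simp [h2, h1, Ne.symm h1]; omega
        · simp [h2, h1, Ne.symm h1]
  have hmod : e % 3 = 0 ∨ e % 3 = 1 ∨ e % 3 = 2 := by omega
  rcases hmod with h | h | h
  · refine ⟨[(x, b), (x, b), (x, b), (y, b), (y, b), (y, b)], rfl, ?_, fun j => ?_⟩
    · simp [FreeGroup.isReduced_cons_cons, hb]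
    · simp only [exponent_mk_cons, exponent_mk_nil]
      split_ifs <;> omega
  · exact hfour true (by simp [signVal]; omega)
  · exact hfour false (by simp [signVal]; omega)

/-- A reduced word has a reduced extension to the left in which all exponent sums of the
generators in `S` are divisible by `3`. -/
theorem exists_prefix_dvd [Nontrivial α] (S : Finset α) {L : List (α × Bool)}
    (hL : FreeGroup.IsReduced L) :
    ∃ v : List (α × Bool), v.length = 6 * S.card ∧ FreeGroup.IsReduced (v ++ L) ∧
      ∀ j ∈ S, (3 : ℤ) ∣ exponent j (FreeGroup.mk (v ++ L)) := by
  induction S using Finset.induction_on with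
  | empty => exact ⟨[], by simpa using hL⟩
  | insert x S hx ih =>
    obtain ⟨v, hv, hr, hd⟩ := ih
    obtain ⟨y, hy⟩ := exists_ne x
    obtain ⟨u, hu, hur, hud⟩ :=
      exists_prefix_six hy.symm hr (-exponent x (FreeGroup.mk (v ++ L)))
    refine ⟨u ++ v, ?_, by simpa using hur, fun j hj => ?_⟩
    · rw [List.length_append, hu, hv, Finset.card_insert_of_notMem hx]; ring
    · rw [List.append_assoc, exponent_mk_append]
      have := hud j
      by_cases h : j = x
      · subst h
        simpa using this
      · rw [if_neg h, sub_zero] at this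
        exact this.add (hd j (Finset.mem_of_mem_insert_of_ne hj h))

end Exponents

section Spheres

variable {α : Type*} [Fintype α] [DecidableEq α]

theorem isReduced_ofFn {β : Type*} [Fintype β] {s : ℕ} {w : Fin s → β × Bool} :
    FreeGroup.IsReduced (List.ofFn w) ↔ w ∈ reducedFns β s := by
  rw [mem_reducedFns, FreeGroup.IsReduced, List.isChain_iff_getElem]
  simp only [List.getElem_ofFn, List.length_ofFn]
  constructor
  · intro h i j hij
    have := h i.val (by omega)
    rwa [show (⟨i.val + 1, by omega⟩ : Fin s) = j from Fin.ext hij.symm] at this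
  · intro h i hi
    exact h _ _ rfl

open Classical in
/-- Elements of the sphere of radius `s` are counted by reduced words of length `s`. -/
theorem ncard_sphere_filter (s : ℕ) (P : FreeGroup α → Prop) :
    {z : FreeGroup α | z.toWord.length = s ∧ P z}.ncard =
      ((reducedFns α s).filter fun w => P (FreeGroup.mk (List.ofFn w))).card := by
  have hw : ∀ w ∈ reducedFns α s, (FreeGroup.mk (List.ofFn w)).toWord = List.ofFn w :=
    fun w hw => by rw [FreeGroup.toWord_mk, (isReduced_ofFn.2 hw).reduce_eq]
  have hinj : Set.InjOn (fun w : Fin s → α × Bool => FreeGroup.mk (List.ofFn w))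
      ((reducedFns α s).filter fun w => P (FreeGroup.mk (List.ofFn w)) : Finset _) := by
    intro w h w' h' heq
    rw [Finset.mem_coe, Finset.mem_filter] at h h'
    have := congrArg FreeGroup.toWord heq
    simp only [hw w h.1, hw w' h'.1] at this
    exact List.ofFn_injective this
  rw [← Finset.card_image_of_injOn hinj, ← Set.ncard_coe_finset]
  congr 1
  ext z
  simp only [Set.mem_ofPred_eq, Finset.coe_image, Set.mem_image, Finset.mem_coe,
    Finset.mem_filter]
  constructor
  · rintro ⟨rfl, hz⟩
    refine ⟨z.toWord.get, ?_⟩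
    rw [← isReduced_ofFn, List.ofFn_get, FreeGroup.mk_toWord]
    exact ⟨⟨FreeGroup.isReduced_toWord, hz⟩, rfl⟩
  · rintro ⟨w, ⟨h1, h2⟩, rfl⟩
    exact ⟨by rw [hw w h1, List.length_ofFn], h2⟩

theorem ncard_sphere (s : ℕ) :
    {z : FreeGroup α | z.toWord.length = s}.ncard = (reducedFns α s).card := by
  classical
  simpa using ncard_sphere_filter s fun _ : FreeGroup α => True

theorem finite_sphere (s : ℕ) : {z : FreeGroup α | z.toWord.length = s}.Finite := by
  refine (List.finite_length_eq (α × Bool) s).preimage (f := FreeGroup.toWord) ?_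
  exact FreeGroup.toWord_injective.injOn

theorem ncard_sphere_pos [Nonempty α] (s : ℕ) :
    0 < {z : FreeGroup α | z.toWord.length = s}.ncard := by
  obtain ⟨x⟩ := ‹Nonempty α›
  rw [Set.ncard_pos (finite_sphere s)]
  exact ⟨FreeGroup.of x ^ s, by simp [FreeGroup.toWord_of_pow]⟩

/-- If every reduced word has a reduced extension by `K` letters to the left with the property
`P`, then this property has positive density on large spheres. -/
theorem ncard_sphere_le_of_prefix [Nonempty α] {K s : ℕ} (hs : K ≤ s) (P : FreeGroup α → Prop)
    (h : ∀ L : List (α × Bool), FreeGroup.IsReduced L →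
      ∃ v : List (α × Bool), v.length = K ∧ FreeGroup.IsReduced (v ++ L) ∧
        P (FreeGroup.mk (v ++ L))) :
    {z : FreeGroup α | z.toWord.length = s}.ncard ≤
      Fintype.card (α × Bool) ^ K * {z : FreeGroup α | z.toWord.length = s ∧ P z}.ncard := by
  classical
  rw [ncard_sphere, ncard_sphere_filter]
  refine card_le_of_rewrite _ _ (Finset.univ.filter fun i : Fin s => i.val < K)
    (by rw [Fin.card_filter_val_lt]; omega) fun w hw => ?_
  obtain ⟨v, hv, hr, hP⟩ := h ((List.ofFn w).drop K)
    ((isReduced_ofFn.2 hw).drop K)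
  have hlen : (v ++ (List.ofFn w).drop K).length = s := by simp [hv]; omega
  have hofFn : List.ofFn (fun i : Fin s => (v ++ (List.ofFn w).drop K)[i.val]'(by omega)) =
      v ++ (List.ofFn w).drop K := by
    apply List.ext_getElem <;> simp [hv]
    omega
  refine ⟨fun i => (v ++ (List.ofFn w).drop K)[i.val]'(by omega), ?_, fun i hi => ?_⟩
  · rw [Finset.mem_filter, ← isReduced_ofFn, hofFn]
    exact ⟨hr, hP⟩
  · simp only [Finset.mem_filter, Finset.mem_univ, true_and, not_lt] at hi
    simp [hv, hi]

end Spheres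

section Ratio

theorem solvRatio_nonneg (n k s t : ℕ) : 0 ≤ solvRatio n k s t := by
  unfold solvRatio; positivity

/-- The solvable equations with sides of length `s` and `t`. -/
def solvablePairs (n k s t : ℕ) : Set (FreeGroup (Fin n) × FreeGroup (Fin k)) :=
  {zw : FreeGroup (Fin n) × FreeGroup (Fin k) |
      zw.1.toWord.length = s ∧ zw.2.toWord.length = t ∧
      ∃ φ : FreeGroup (Fin n) →* FreeGroup (Fin k), φ zw.1 = zw.2}

theorem solvRatio_eq (n k s t : ℕ) : solvRatio n k s t = ((solvablePairs n k s t).ncard : ℝ) /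
    (({z : FreeGroup (Fin n) | z.toWord.length = s}.ncard : ℝ) *
      ({w : FreeGroup (Fin k) | w.toWord.length = t}.ncard : ℝ)) := rfl

theorem solvablePairs_subset (n k s t : ℕ) : solvablePairs n k s t ⊆
    {z : FreeGroup (Fin n) | z.toWord.length = s} ×ˢ
      {w : FreeGroup (Fin k) | w.toWord.length = t} := fun _ h => ⟨h.1, h.2.1⟩

theorem finite_solvablePairs (n k s t : ℕ) : (solvablePairs n k s t).Finite :=
  ((finite_sphere s).prod (finite_sphere t)).subset (solvablePairs_subset n k s t)

theorem solvRatio_le_one (n k s t : ℕ) : solvRatio n k s t ≤ 1 := by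
  rw [solvRatio_eq]
  refine div_le_one_of_le₀ ?_ (by positivity)
  rw [← Nat.cast_mul, ← Set.ncard_prod]
  exact_mod_cast Set.ncard_le_ncard (solvablePairs_subset n k s t)
    ((finite_sphere s).prod (finite_sphere t))

/-- The proportion of solvable equations is bounded from below. -/
theorem exists_eventually_le_solvRatio {n k : ℕ} (hn : 2 ≤ n) (hk : 2 ≤ k) :
    ∃ c : ℝ, 0 < c ∧ ∀ᶠ s in atTop, ∀ t, c ≤ solvRatio n k s t := by
  have : Nonempty (Fin n) := ⟨⟨0, by omega⟩⟩
  have : Nonempty (Fin k) := ⟨⟨0, by omega⟩⟩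
  have hxy : (⟨0, by omega⟩ : Fin n) ≠ ⟨1, by omega⟩ := by simp
  set x : Fin n := ⟨0, by omega⟩
  set y : Fin n := ⟨1, by omega⟩
  set C := 16 * Fintype.card (Fin n × Bool) ^ 6 with hC
  have hC0 : 0 < C := by have := Fintype.card_pos (α := Fin n × Bool); positivity
  refine ⟨1 / C, by positivity, ?_⟩
  filter_upwards [eventually_card_reducedFns_le_gcd hxy] with s hs t
  set A := {z : FreeGroup (Fin n) | z.toWord.length = s ∧
    Int.gcd (exponent x z) (exponent y z) = 1} with hA
  have hAs : {z : FreeGroup (Fin n) | z.toWord.length = s}.ncard ≤ C * A.ncard := by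
    rw [hA, ncard_sphere, ncard_sphere_filter]
    simp_rw [exponent_mk_ofFn]
    convert hs
  have hS := ncard_sphere_pos (α := Fin n) s
  have hT := ncard_sphere_pos (α := Fin k) t
  have hle : A.ncard * {w : FreeGroup (Fin k) | w.toWord.length = t}.ncard ≤
      (solvablePairs n k s t).ncard := by
    rw [← Set.ncard_prod]
    exact Set.ncard_le_ncard (fun zw h => ⟨h.1.1, h.2, exists_hom_of_gcd_eq_one h.1.2 zw.2⟩)
      (finite_solvablePairs n k s t)
  rw [solvRatio_eq, div_le_div_iff₀ (by positivity) (by positivity)]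
  norm_cast
  calc _ ≤ 1 * (C * A.ncard * _) := Nat.mul_le_mul_left _ (Nat.mul_le_mul_right _ hAs)
    _ = A.ncard * {w : FreeGroup (Fin k) | w.toWord.length = t}.ncard * C := by ring
    _ ≤ _ := Nat.mul_le_mul_right _ hle

/-- The proportion of solvable equations is bounded away from one. -/
theorem exists_solvRatio_le {n k : ℕ} (hn : 2 ≤ n) (hk : 2 ≤ k) :
    ∃ c : ℝ, c < 1 ∧ ∀ s ≥ 6 * n, ∀ t ≥ 6, solvRatio n k s t ≤ c := by
  have : Nontrivial (Fin n) := Fin.nontrivial_iff_two_le.2 hn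
  have : Nontrivial (Fin k) := Fin.nontrivial_iff_two_le.2 hk
  set C := Fintype.card (Fin n × Bool) ^ (6 * n) with hC
  set D := Fintype.card (Fin k × Bool) ^ 6 with hD
  have hC0 : 0 < C := by have := Fintype.card_pos (α := Fin n × Bool); positivity
  have hD0 : 0 < D := by have := Fintype.card_pos (α := Fin k × Bool); positivity
  refine ⟨1 - 1 / (C * D), sub_lt_self _ (by positivity), fun s hs t ht => ?_⟩
  obtain ⟨x, y, hxy⟩ := exists_pair_ne (Fin k)
  set S := {z : FreeGroup (Fin n) | z.toWord.length = s} with hSdef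
  set T := {w : FreeGroup (Fin k) | w.toWord.length = t} with hTdef
  set A := {z : FreeGroup (Fin n) | z.toWord.length = s ∧ ∀ i, (3 : ℤ) ∣ exponent i z}
  set B := {w : FreeGroup (Fin k) | w.toWord.length = t ∧ ¬ (3 : ℤ) ∣ exponent x w}
  have hA : S.ncard ≤ C * A.ncard := by
    refine ncard_sphere_le_of_prefix hs _ fun L hL => ?_
    obtain ⟨v, hv, hr, hd⟩ := exists_prefix_dvd Finset.univ hL
    exact ⟨v, by simpa using hv, hr, fun i => hd i (Finset.mem_univ i)⟩
  have hB : T.ncard ≤ D * B.ncard := by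
    refine ncard_sphere_le_of_prefix ht _ fun L hL => ?_
    obtain ⟨v, hv, hr, hd⟩ := exists_prefix_six hxy hL (1 - exponent x (FreeGroup.mk L))
    refine ⟨v, hv, hr, fun h => ?_⟩
    rw [exponent_mk_append] at h
    have := hd x
    rw [if_pos rfl] at this
    omega
  have hS : 0 < S.ncard := ncard_sphere_pos s
  have hT : 0 < T.ncard := ncard_sphere_pos t
  have hsub : A ×ˢ B ⊆ S ×ˢ T := Set.prod_mono (fun _ h => h.1) fun _ h => h.1
  have hfin : (S ×ˢ T).Finite := (finite_sphere s).prod (finite_sphere t)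
  have hle : (solvablePairs n k s t).ncard +
      A.ncard * B.ncard ≤ S.ncard * T.ncard := by
    rw [← Set.ncard_prod, ← Set.ncard_prod,
      ← Set.ncard_union_eq ?_ (finite_solvablePairs n k s t) (hfin.subset hsub)]
    · exact Set.ncard_le_ncard (Set.union_subset (solvablePairs_subset n k s t) hsub) hfin
    · refine Set.disjoint_left.2 ?_
      rintro ⟨z, w⟩ ⟨_, _, φ, hφ⟩ ⟨hz, hw⟩
      simp only at hφ hz hw
      subst hφ
      exact hw.2 (dvd_exponent_map hz.2 φ x)
  have hprod : (S.ncard * T.ncard : ℝ) ≤ C * D * (A.ncard * B.ncard) := by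
    exact_mod_cast (Nat.mul_le_mul hA hB).trans_eq (by ring)
  rw [solvRatio_eq, div_le_iff₀ (by positivity)]
  have hle' := (Nat.cast_le (α := ℝ)).2 hle
  push_cast at hle'
  have hdiv : 1 / (C * D : ℝ) * (S.ncard * T.ncard) ≤ A.ncard * B.ncard := by
    rw [one_div, inv_mul_le_iff₀ (by positivity)]
    exact hprod
  change _ ≤ _ * ((S.ncard : ℝ) * T.ncard)
  linarith

end Ratio

/-- For `n, k ≥ 2`, the probability of an `(s,t)`-homogeneous equation in `n` variables
in the free group of rank `k` to be solvable satisfies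
`0 < liminf_{(s,t)→(∞,∞)} A(s,t) ≤ limsup_{(s,t)→(∞,∞)} A(s,t) < 1`. -/
theorem stmt_18 (n k : ℕ) (hn : 2 ≤ n) (hk : 2 ≤ k) :
    0 < liminf (fun st : ℕ × ℕ => solvRatio n k st.1 st.2) (atTop ×ˢ atTop) ∧
    liminf (fun st : ℕ × ℕ => solvRatio n k st.1 st.2) (atTop ×ˢ atTop) ≤
      limsup (fun st : ℕ × ℕ => solvRatio n k st.1 st.2) (atTop ×ˢ atTop) ∧
    limsup (fun st : ℕ × ℕ => solvRatio n k st.1 st.2) (atTop ×ˢ atTop) < 1 := by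
  obtain ⟨c, hc, hlow⟩ := exists_eventually_le_solvRatio hn hk
  obtain ⟨d, hd, hup⟩ := exists_solvRatio_le hn hk
  have hle : IsBoundedUnder (· ≤ ·) (atTop ×ˢ atTop)
      fun st : ℕ × ℕ => solvRatio n k st.1 st.2 :=
    isBoundedUnder_of ⟨1, fun st => solvRatio_le_one n k st.1 st.2⟩
  have hge : IsBoundedUnder (· ≥ ·) (atTop ×ˢ atTop)
      fun st : ℕ × ℕ => solvRatio n k st.1 st.2 :=
    isBoundedUnder_of ⟨0, fun st => solvRatio_nonneg n k st.1 st.2⟩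
  refine ⟨hc.trans_le (le_liminf_of_le hle.isCoboundedUnder_ge ?_), liminf_le_limsup hle hge,
    (limsup_le_of_le hge.isCoboundedUnder_le ?_).trans_lt hd⟩
  · filter_upwards [hlow.prod_inl atTop] with st hst using hst st.2
  · filter_upwards [(eventually_ge_atTop (6 * n)).prod_mk (eventually_ge_atTop 6)] with st hst
    exact hup st.1 hst.1 st.2 hst.2
end
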